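/- arXiv:1711.07590 — 4 statements merged into one kernel-verified Lean document; each statement's English description precedes it below -/
import Mathlib

section
/- Let ω be a nonnegative σ-finite measure on ℝ² = ℂ satisfying ω(B(0,r)) = c·r^α for every r > 0, with constants c > 0 and α ∈ (0,1). Then the local kinetic energy satisfies, for every r > 0, the two-sided bound (c²/(4πα))·r^{2α} ≤ E_r(ω) ≤ (c²·α·π/(4·sin²(πα)))·r^{2α}. -/
open MeasureTheory Metric Real Filter
open scoped ENNReal NNReal Topology

/-- Biot-Savart velocity field of a vorticity measure `ω` on `ℂ = ℝ²`:
`v(z) = (2π)⁻¹ ∫ i (z - u) / |z - u|² dω(u)`. -/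
noncomputable def biotSavart (ω : Measure ℂ) (z : ℂ) : ℂ :=
  (2 * π)⁻¹ • ∫ u, Complex.I * (z - u) / (((‖z - u‖ : ℝ) : ℂ) ^ 2) ∂ω

/-- Local kinetic energy `E_r(ω) = ∫_{B(0,r)} |v|²`. -/
noncomputable def localEnergy (ω : Measure ℂ) (r : ℝ) : ℝ≥0∞ :=
  ∫⁻ x in ball (0 : ℂ) r, (‖biotSavart ω x‖₊ : ℝ≥0∞) ^ 2

/-- Spherical average `A_r(ω) = (2π)⁻¹ ∫_0^{2π} |v(r e^{iθ})|² dθ`. -/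
noncomputable def sphAvg (ω : Measure ℂ) (r : ℝ) : ℝ≥0∞ :=
  (ENNReal.ofReal (2 * π))⁻¹ *
    ∫⁻ θ in Set.Ioo (0 : ℝ) (2 * π),
      (‖biotSavart ω ((r : ℂ) * Complex.exp ((θ : ℂ) * Complex.I))‖₊ : ℝ≥0∞) ^ 2

/-- Inner moments `m_{r,n}(ω) = ∫_{B(0,r)} uⁿ dω(u)` (for `n = 0` this is `ω(B(0,r))`). -/
noncomputable def innerMoment (ω : Measure ℂ) (r : ℝ) (n : ℕ) : ℂ :=
  ∫ u in ball (0 : ℂ) r, u ^ n ∂ω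

/-- Outer moments `M_{r,k}(ω) = ∫_{ℂ ∖ B(0,r)} u⁻ᵏ dω(u)`. -/
noncomputable def outerMoment (ω : Measure ℂ) (r : ℝ) (k : ℕ) : ℂ :=
  ∫ u in (ball (0 : ℂ) r)ᶜ, u ^ (-(k : ℤ)) ∂ω

lemma lintegral_Ioo_ofReal_mul_rpow {A p R : ℝ} (hA : 0 ≤ A) (hp : -1 < p) (hR : 0 ≤ R) :
    ∫⁻ x in Set.Ioo 0 R, ENNReal.ofReal (A * x ^ p) =
      ENNReal.ofReal (A * (R ^ (p + 1) / (p + 1))) := by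
  rw [setLIntegral_congr Ioo_ae_eq_Ioc, ← ofReal_integral_eq_lintegral_ofReal]
  · rw [integral_const_mul, ← intervalIntegral.integral_of_le hR, integral_rpow (Or.inl hp),
      Real.zero_rpow (by linarith), sub_zero]
  · exact ((intervalIntegral.intervalIntegrable_rpow' hp).1).const_mul A
  · refine (ae_restrict_iff' measurableSet_Ioc).2 (ae_of_all _ fun x hx => ?_)
    exact mul_nonneg hA (Real.rpow_nonneg hx.1.le _)

lemma lintegral_Ioi_ofReal_mul_rpow {A p R : ℝ} (hA : 0 ≤ A) (hp : p < -1) (hR : 0 < R) :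
    ∫⁻ x in Set.Ioi R, ENNReal.ofReal (A * x ^ p) =
      ENNReal.ofReal (A * (-R ^ (p + 1) / (p + 1))) := by
  rw [← ofReal_integral_eq_lintegral_ofReal]
  · rw [integral_const_mul, integral_Ioi_rpow_of_lt hp hR]
  · exact (integrableOn_Ioi_rpow_of_lt hp hR).const_mul A
  · refine (ae_restrict_iff' measurableSet_Ioi).2 (ae_of_all _ fun x hx => ?_)
    exact mul_nonneg hA (Real.rpow_nonneg (hR.le.trans (le_of_lt hx)) _)

lemma map_norm_eq_withDensity {ω : Measure ℂ} {c α : ℝ} (hc : 0 < c) (hα : 0 < α)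
    (hω : ∀ r > (0 : ℝ), ω (ball (0 : ℂ) r) = ENNReal.ofReal (c * r ^ α)) :
    ω.map (fun u => ‖u‖) = (volume.restrict (Set.Ioi (0 : ℝ))).withDensity
      fun x => ENNReal.ofReal (c * α * x ^ (α - 1)) := by
  have hball : ∀ x : ℝ, ω (ball (0 : ℂ) x) = ENNReal.ofReal (c * (max x 0) ^ α) := by
    intro x
    rcases le_or_gt x 0 with hx | hx
    · rw [ball_eq_empty.2 hx, max_eq_right hx, Real.zero_rpow hα.ne']
      simp
    · rw [hω x hx, max_eq_left hx.le]
  have h1 : ∀ x : ℝ, ω.map (fun u => ‖u‖) (Set.Iio x) = ENNReal.ofReal (c * (max x 0) ^ α) := by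
    intro x
    rw [Measure.map_apply measurable_norm measurableSet_Iio, ← hball]
    congr 1
    ext u
    simp
  have h2 : ∀ x : ℝ, ((volume.restrict (Set.Ioi (0 : ℝ))).withDensity
      fun x => ENNReal.ofReal (c * α * x ^ (α - 1))) (Set.Iio x) =
        ENNReal.ofReal (c * (max x 0) ^ α) := by
    intro x
    rw [withDensity_apply _ measurableSet_Iio, Measure.restrict_restrict measurableSet_Iio]
    have : Set.Iio x ∩ Set.Ioi 0 = Set.Ioo 0 (max x 0) := by
      ext y
      simp only [Set.mem_inter_iff, Set.mem_Iio, Set.mem_Ioi, Set.mem_Ioo, lt_max_iff]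
      constructor
      · rintro ⟨h, h'⟩; exact ⟨h', Or.inl h⟩
      · rintro ⟨h, h' | h'⟩
        · exact ⟨h', h⟩
        · exact absurd h h'.not_gt
    rw [this, lintegral_Ioo_ofReal_mul_rpow (by positivity) (by linarith) (le_max_right _ _)]
    congr 1
    rw [sub_add_cancel]
    field_simp
  refine Measure.ext_of_Ico' _ _ (fun a b _ => ?_) fun a b hab => ?_
  · refine ne_top_of_le_ne_top ?_ (measure_mono Set.Ico_subset_Iio_self)
    rw [h1]
    exact ENNReal.ofReal_ne_top
  · have : Set.Ico a b = Set.Iio b \ Set.Iio a := by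
      ext y; simp
    rw [this, measure_sdiff (Set.Iio_subset_Iio hab.le) measurableSet_Iio.nullMeasurableSet,
      measure_sdiff (Set.Iio_subset_Iio hab.le) measurableSet_Iio.nullMeasurableSet, h1, h1, h2, h2]
    · rw [h2]; exact ENNReal.ofReal_ne_top
    · rw [h1]; exact ENNReal.ofReal_ne_top

lemma lintegral_norm_eq {ω : Measure ℂ} {c α : ℝ} (hc : 0 < c) (hα : 0 < α)
    (hω : ∀ r > (0 : ℝ), ω (ball (0 : ℂ) r) = ENNReal.ofReal (c * r ^ α))
    {f : ℝ → ℝ≥0∞} (hf : Measurable f) {s : Set ℝ} (hs : MeasurableSet s) :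
    ∫⁻ u in (fun u : ℂ => ‖u‖) ⁻¹' s, f ‖u‖ ∂ω =
      ∫⁻ x in s ∩ Set.Ioi 0, ENNReal.ofReal (c * α * x ^ (α - 1)) * f x := by
  rw [← setLIntegral_map hs hf measurable_norm, map_norm_eq_withDensity hc hα hω,
    setLIntegral_withDensity_eq_setLIntegral_mul _ (by fun_prop) hf hs,
    Measure.restrict_restrict hs]
  rfl

lemma measure_sphere_eq_zero {ω : Measure ℂ} {c α : ℝ} (hc : 0 < c) (hα : 0 < α)
    (hω : ∀ r > (0 : ℝ), ω (ball (0 : ℂ) r) = ENNReal.ofReal (c * r ^ α)) (r : ℝ) :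
    ω (sphere (0 : ℂ) r) = 0 := by
  have h := lintegral_norm_eq hc hα hω (measurable_const (a := (1 : ℝ≥0∞)))
    (measurableSet_singleton r)
  have hsph : (fun u : ℂ => ‖u‖) ⁻¹' {r} = sphere (0 : ℂ) r := by ext; simp
  rw [hsph, setLIntegral_one] at h
  rw [h]
  exact setLIntegral_measure_zero _ _
    (measure_mono_null Set.inter_subset_left (Real.volume_singleton))

lemma lintegral_ball_pow {ω : Measure ℂ} {c α : ℝ} (hc : 0 < c) (hα : 0 < α)
    (hω : ∀ r > (0 : ℝ), ω (ball (0 : ℂ) r) = ENNReal.ofReal (c * r ^ α)) {r : ℝ} (hr : 0 < r)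
    (n : ℕ) :
    ∫⁻ u in ball (0 : ℂ) r, ‖u ^ n‖ₑ ∂ω =
      ENNReal.ofReal (c * α * (r ^ (n + α) / (n + α))) := by
  have h := lintegral_norm_eq hc hα hω (f := fun x => ENNReal.ofReal (x ^ n)) (by fun_prop)
    (measurableSet_Iio (a := r))
  have hs : (fun u : ℂ => ‖u‖) ⁻¹' Set.Iio r = ball (0 : ℂ) r := by ext; simp
  have hs' : Set.Iio r ∩ Set.Ioi 0 = Set.Ioo 0 r := by rw [Set.inter_comm, Set.Ioi_inter_Iio]
  rw [hs, hs'] at h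
  simp_rw [← ofReal_norm, norm_pow]
  rw [h, setLIntegral_congr_fun (g := fun x => ENNReal.ofReal (c * α * x ^ (n + α - 1)))
    measurableSet_Ioo, lintegral_Ioo_ofReal_mul_rpow (by positivity) _ hr.le]
  · rw [sub_add_cancel]
  · have : (0 : ℝ) ≤ n := n.cast_nonneg
    linarith
  · intro x hx
    have hx0 := hx.1
    dsimp only
    rw [← ENNReal.ofReal_mul (by positivity), mul_assoc, ← Real.rpow_natCast,
      ← Real.rpow_add hx0]
    ring_nf

lemma lintegral_ball_compl_zpow {ω : Measure ℂ} {c α : ℝ} (hc : 0 < c) (hα : α ∈ Set.Ioo (0 : ℝ) 1)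
    (hω : ∀ r > (0 : ℝ), ω (ball (0 : ℂ) r) = ENNReal.ofReal (c * r ^ α)) {r : ℝ} (hr : 0 < r)
    (n : ℕ) :
    ∫⁻ u in (ball (0 : ℂ) r)ᶜ, ‖u ^ (-((n + 1 : ℕ) : ℤ))‖ₑ ∂ω =
      ENNReal.ofReal (c * α * (r ^ (α - (n + 1)) / (n + 1 - α))) := by
  obtain ⟨hα0, hα1⟩ := hα
  have hn : (0 : ℝ) ≤ n := n.cast_nonneg
  have h := lintegral_norm_eq hc hα0 hω
    (f := fun x => ENNReal.ofReal (x ^ (-((n + 1 : ℕ) : ℤ)))) (by fun_prop)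
    (measurableSet_Ici (a := r))
  have hs : (fun u : ℂ => ‖u‖) ⁻¹' Set.Ici r = (ball (0 : ℂ) r)ᶜ := by ext; simp
  have hs' : Set.Ici r ∩ Set.Ioi 0 = Set.Ici r :=
    Set.inter_eq_left.2 fun x hx => hr.trans_le hx
  rw [hs, hs', setLIntegral_congr Ioi_ae_eq_Ici.symm] at h
  simp_rw [← ofReal_norm, norm_zpow]
  rw [h, setLIntegral_congr_fun (g := fun x => ENNReal.ofReal (c * α * x ^ (α - (n + 1) - 1)))
    measurableSet_Ioi, lintegral_Ioi_ofReal_mul_rpow (by positivity) (by linarith) hr]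
  · rw [sub_add_cancel, neg_div, ← div_neg, neg_sub]
  · intro x hx
    have hx0 : 0 < x := hr.trans hx
    dsimp only
    rw [← ENNReal.ofReal_mul (by positivity), mul_assoc, ← Real.rpow_intCast,
      ← Real.rpow_add hx0]
    push_cast
    ring_nf

lemma integral_exp_int_mul (n : ℤ) :
    ∫ θ in (-π)..π, Complex.exp (n * θ * Complex.I) = if n = 0 then (2 * π : ℂ) else 0 := by
  split_ifs with h
  · subst h
    simp
    ring
  · have hn : (n : ℂ) * Complex.I ≠ 0 := by simp [h]
    have := integral_exp_mul_complex (a := -π) (b := π) hn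
    simp_rw [mul_right_comm _ Complex.I] at this
    rw [this]
    have : Complex.exp (n * (π : ℝ) * Complex.I) = Complex.exp (n * ((-π : ℝ) : ℂ) * Complex.I) := by
      rw [Complex.exp_eq_exp_iff_exists_int]
      refine ⟨n, ?_⟩
      push_cast
      ring
    rw [this, sub_self, zero_div]

/-- Parseval's identity for trigonometric polynomials. -/
lemma integral_norm_sq_trigPoly {ι : Type*} (s : Finset ι) (c : ι → ℂ) {f : ι → ℤ}
    (hf : Function.Injective f) :
    ∫ θ in (-π)..π, ‖∑ i ∈ s, c i * Complex.exp (f i * θ * Complex.I)‖ ^ 2 =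
      2 * π * ∑ i ∈ s, ‖c i‖ ^ 2 := by
  classical
  have key : ∀ θ : ℝ, ((‖∑ i ∈ s, c i * Complex.exp (f i * θ * Complex.I)‖ ^ 2 : ℝ) : ℂ) =
      ∑ i ∈ s, ∑ j ∈ s, c i * (starRingEnd ℂ) (c j) *
        Complex.exp ((f i - f j : ℤ) * θ * Complex.I) := by
    intro θ
    rw [Complex.ofReal_pow, ← Complex.mul_conj', map_sum, Finset.sum_mul_sum]
    refine Finset.sum_congr rfl fun i _ => Finset.sum_congr rfl fun j _ => ?_
    rw [map_mul, ← Complex.exp_conj, mul_mul_mul_comm, ← Complex.exp_add]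
    congr 2
    simp
    ring
  apply Complex.ofReal_injective
  rw [← intervalIntegral.integral_ofReal]
  simp_rw [key]
  rw [intervalIntegral.integral_finsetSum
    (fun i _ => (by fun_prop : Continuous _).intervalIntegrable _ _)]
  simp only [Complex.ofReal_mul, Complex.ofReal_sum, Complex.ofReal_pow, Complex.ofReal_ofNat]
  rw [Finset.mul_sum]
  refine Finset.sum_congr rfl fun i hi => ?_
  rw [intervalIntegral.integral_finsetSum
    (fun i _ => (by fun_prop : Continuous _).intervalIntegrable _ _)]
  simp_rw [intervalIntegral.integral_const_mul, integral_exp_int_mul, sub_eq_zero, hf.eq_iff]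
  rw [Finset.sum_eq_single i (fun j _ hj => by simp [hj.symm]) (fun h => absurd hi h), if_pos rfl,
    Complex.mul_conj']
  ring

/-- The Mittag-Leffler expansion of `π² / sin²`, as an inequality for finite sums. -/
lemma sum_inv_sq_le {ι : Type*} (s : Finset ι) {f : ι → ℤ} (hf : Function.Injective f)
    {α : ℝ} (hα : α ∈ Set.Ioo (0 : ℝ) 1) :
    ∑ i ∈ s, (1 / (α - f i)) ^ 2 ≤ π ^ 2 / Real.sin (π * α) ^ 2 := by
  have hne : ∀ n : ℤ, α - n ≠ 0 := by
    intro n hn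
    have h1 : α = n := by linarith
    have h2 := hα.1
    have h3 := hα.2
    rw [h1] at h2 h3
    norm_cast at h2 h3
    omega
  have hsin : 0 < Real.sin (π * α) :=
    Real.sin_pos_of_pos_of_lt_pi (by have := hα.1; positivity)
      (by have := hα.2; nlinarith [Real.pi_pos])
  have hab : (0 : ℝ) < 1 := one_pos
  have hcont : Continuous fun x : ℝ => Complex.exp (2 * π * α * Complex.I * x) := by fun_prop
  have hL2 : MemLp (fun x : ℝ => Complex.exp (2 * π * α * Complex.I * x)) 2
      (volume.restrict (Set.Ioc (0 : ℝ) 1)) := by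
    refine MemLp.of_bound hcont.aestronglyMeasurable 1 (ae_of_all _ fun x => ?_)
    rw [Complex.norm_exp]
    simp
  have h := hasSum_sq_fourierCoeffOn hab hL2
  have hcoef : ∀ n : ℤ, ‖fourierCoeffOn hab
      (fun x : ℝ => Complex.exp (2 * π * α * Complex.I * x)) n‖ ^ 2 =
        Real.sin (π * α) ^ 2 / π ^ 2 * (1 / (α - n)) ^ 2 := by
    intro n
    have hne' : (2 * π * (α - n) * Complex.I : ℂ) ≠ 0 := by
      have h1 : (α - n : ℂ) ≠ 0 := by exact_mod_cast hne n
      have h2 : (π : ℂ) ≠ 0 := by exact_mod_cast Real.pi_ne_zero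
      simp [h1, h2]
    rw [fourierCoeffOn_eq_integral]
    have : ∀ x : ℝ, fourier (-n) (x : AddCircle ((1 : ℝ) - 0)) •
        Complex.exp (2 * π * α * Complex.I * x) =
        Complex.exp ((2 * π * (α - n) * Complex.I) * x) := by
      intro x
      rw [fourier_coe_apply, smul_eq_mul, ← Complex.exp_add]
      congr 1
      push_cast
      ring
    simp_rw [this]
    rw [integral_exp_mul_complex hne', Complex.ofReal_one, Complex.ofReal_zero, mul_one, mul_zero,
      Complex.exp_zero]
    have h3 : Complex.exp (2 * π * (α - n) * Complex.I) = Complex.exp (2 * π * α * Complex.I) := by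
      rw [Complex.exp_eq_exp_iff_exists_int]
      refine ⟨-n, ?_⟩
      push_cast
      ring
    have h4 : ‖Complex.exp (2 * π * α * Complex.I) - 1‖ = 2 * Real.sin (π * α) := by
      have := Complex.norm_exp_I_mul_ofReal_sub_one (2 * π * α)
      rw [show Complex.I * ((2 * π * α : ℝ) : ℂ) = 2 * π * α * Complex.I by push_cast; ring] at this
      rw [this, show 2 * π * α / 2 = π * α by ring, Real.norm_eq_abs, abs_of_pos (by positivity)]
    have h5 : ‖(2 * π * (α - n) * Complex.I : ℂ)‖ = 2 * π * |α - n| := by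
      rw [norm_mul, norm_mul, norm_mul, Complex.norm_I, ← Complex.ofReal_intCast,
        ← Complex.ofReal_sub, Complex.norm_real, Complex.norm_real]
      simp [abs_of_pos Real.pi_pos]
    rw [norm_smul, h3, norm_div (_ - 1), h4, h5]
    have := hne n
    simp only [sub_zero, norm_one, div_one, one_mul, mul_pow, div_pow, sq_abs]
    field_simp
  have hint : (∫ x in (0 : ℝ)..1, ‖Complex.exp (2 * π * α * Complex.I * x)‖ ^ 2) = 1 := by
    have : ∀ x : ℝ, ‖Complex.exp (2 * π * α * Complex.I * x)‖ = 1 := by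
      intro x
      rw [Complex.norm_exp]
      simp
    simp [this]
  simp_rw [hcoef, hint] at h
  have hle := sum_le_hasSum (s.map ⟨f, hf⟩) (fun i _ => by positivity) h
  rw [← Finset.mul_sum, Finset.sum_map] at hle
  simp only [Function.Embedding.coeFn_mk, sub_zero, inv_one, smul_eq_mul, mul_one] at hle
  rw [div_mul_eq_mul_div, div_le_one (by positivity)] at hle
  rw [le_div_iff₀ (by positivity)]
  linarith

lemma norm_biotSavart (ω : Measure ℂ) (z : ℂ) :
    ‖biotSavart ω z‖ = (2 * π)⁻¹ * ‖∫ u, (z - u)⁻¹ ∂ω‖ := by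
  have h : ∀ u : ℂ, Complex.I * (z - u) / (((‖z - u‖ : ℝ) : ℂ) ^ 2) =
      Complex.I * (starRingEnd ℂ) ((z - u)⁻¹) := by
    intro u
    rw [Complex.inv_def, map_mul, Complex.conj_conj, Complex.conj_ofReal, mul_div_assoc,
      Complex.normSq_eq_norm_sq]
    push_cast
    rw [div_eq_mul_inv]
  unfold biotSavart
  simp_rw [h]
  rw [integral_const_mul, integral_conj, norm_smul, norm_mul, Complex.norm_I, one_mul,
    Complex.norm_conj, Real.norm_eq_abs, abs_of_pos (by positivity)]

/-- The partial sums of the Laurent-type expansion of the Cauchy transform on `|z| = r`. -/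
noncomputable def laurentSum (ω : Measure ℂ) (r : ℝ) (N : ℕ) (z : ℂ) : ℂ :=
  ∑ n ∈ Finset.range N, innerMoment ω r n * (z ^ (n + 1))⁻¹ -
    ∑ n ∈ Finset.range N, outerMoment ω r (n + 1) * z ^ n

lemma sum_pow_mul_inv_pow_succ {u z : ℂ} (hz : z ≠ 0) (hu : z ≠ u) (N : ℕ) :
    ∑ n ∈ Finset.range N, u ^ n * (z ^ (n + 1))⁻¹ = (1 - (u / z) ^ N) * (z - u)⁻¹ := by
  have h : ∀ n, u ^ n * (z ^ (n + 1))⁻¹ = (u / z) ^ n * z⁻¹ := by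
    intro n
    rw [div_pow, pow_succ]
    field_simp
  have h1 : u / z ≠ 1 := by
    rw [Ne, div_eq_one_iff_eq hz]
    exact hu.symm
  have h2 : z - u ≠ 0 := sub_ne_zero.2 hu
  have h3 : u - z ≠ 0 := sub_ne_zero.2 hu.symm
  simp_rw [h]
  rw [← Finset.sum_mul, geom_sum_eq h1, div_mul_eq_mul_div, mul_comm _ (z - u)⁻¹,
    show u / z - 1 = (u - z) / z by field_simp]
  rw [show u - z = -(z - u) by ring]
  generalize (u / z) ^ N = w
  field_simp
  ring

lemma norm_one_sub_pow_mul_le {q w : ℂ} (hq : ‖q‖ ≤ 1) (N : ℕ) :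
    ‖(1 - q ^ N) * w‖ ≤ 2 * ‖w‖ := by
  rw [norm_mul]
  refine mul_le_mul_of_nonneg_right ?_ (norm_nonneg _)
  refine (norm_sub_le _ _).trans ?_
  rw [norm_one, norm_pow]
  linarith [pow_le_one₀ (norm_nonneg q) hq (n := N)]

lemma tendsto_one_sub_pow_mul {q : ℂ} (w : ℂ) (hq : ‖q‖ < 1) :
    Tendsto (fun N : ℕ => (1 - q ^ N) * w) atTop (𝓝 w) := by
  simpa using ((tendsto_pow_atTop_nhds_zero_of_norm_lt_one hq).const_sub 1).mul_const w

lemma tendsto_laurentSum {ω : Measure ℂ} {r : ℝ} (hr : 0 < r) (hsph : ω (sphere (0 : ℂ) r) = 0)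
    (hin : ∀ n : ℕ, IntegrableOn (fun u : ℂ => u ^ n) (ball (0 : ℂ) r) ω)
    (hout : ∀ n : ℕ, IntegrableOn (fun u : ℂ => u ^ (-((n + 1 : ℕ) : ℤ))) (ball (0 : ℂ) r)ᶜ ω)
    {z : ℂ} (hz : ‖z‖ = r) (hint : Integrable (fun u : ℂ => (z - u)⁻¹) ω) :
    Tendsto (fun N => laurentSum ω r N z) atTop (𝓝 (∫ u, (z - u)⁻¹ ∂ω)) := by
  have hz0 : z ≠ 0 := by
    rintro rfl
    simp at hz
    exact hr.ne hz
  have hne : ∀ᵐ u ∂ω, ‖u‖ ≠ r := by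
    rw [ae_iff]
    convert hsph using 2
    ext u
    simp
  rw [← integral_add_compl (s := ball (0 : ℂ) r) measurableSet_ball hint]
  unfold laurentSum
  simp_rw [sub_eq_add_neg]
  refine Tendsto.add ?_ ?_
  · have h : ∀ N, ∑ n ∈ Finset.range N, innerMoment ω r n * (z ^ (n + 1))⁻¹ =
        ∫ u in ball (0 : ℂ) r, ∑ n ∈ Finset.range N, u ^ n * (z ^ (n + 1))⁻¹ ∂ω := by
      intro N
      rw [integral_finsetSum _ fun n _ => (hin n).mul_const _]
      simp_rw [integral_mul_const]
      rfl
    simp_rw [h]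
    refine tendsto_integral_of_dominated_convergence (fun u => 2 * ‖(z - u)⁻¹‖)
      (fun N => (integrable_finsetSum _ fun n _ => (hin n).mul_const _).aestronglyMeasurable)
      (hint.norm.const_mul 2).integrableOn (fun N => ?_) ?_
    · refine (ae_restrict_iff' measurableSet_ball).2 (ae_of_all _ fun u hu => ?_)
      rw [mem_ball_zero_iff] at hu
      have hzu : z ≠ u := by rintro rfl; linarith
      rw [sum_pow_mul_inv_pow_succ hz0 hzu]
      refine norm_one_sub_pow_mul_le ?_ N
      rw [norm_div, hz]
      exact (div_le_one hr).2 hu.le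
    · refine (ae_restrict_iff' measurableSet_ball).2 (ae_of_all _ fun u hu => ?_)
      rw [mem_ball_zero_iff] at hu
      have hzu : z ≠ u := by rintro rfl; linarith
      simp_rw [sum_pow_mul_inv_pow_succ hz0 hzu]
      refine tendsto_one_sub_pow_mul _ ?_
      rw [norm_div, hz]
      exact (div_lt_one hr).2 hu
  · have h : ∀ N, -∑ n ∈ Finset.range N, outerMoment ω r (n + 1) * z ^ n =
        ∫ u in (ball (0 : ℂ) r)ᶜ,
          -∑ n ∈ Finset.range N, u ^ (-((n + 1 : ℕ) : ℤ)) * z ^ n ∂ω := by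
      intro N
      rw [integral_neg, integral_finsetSum _ fun n _ => (hout n).mul_const _]
      simp_rw [integral_mul_const]
      rfl
    have hsum : ∀ N (u : ℂ), u ≠ 0 → u ≠ z →
        -∑ n ∈ Finset.range N, u ^ (-((n + 1 : ℕ) : ℤ)) * z ^ n =
          (1 - (z / u) ^ N) * (z - u)⁻¹ := by
      intro N u hu0 huz
      have := sum_pow_mul_inv_pow_succ hu0 huz N
      rw [← neg_sub u z, inv_neg, mul_neg, ← this]
      congr 1
      refine Finset.sum_congr rfl fun n _ => ?_
      rw [zpow_neg, zpow_natCast, mul_comm]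
    simp_rw [h]
    refine tendsto_integral_of_dominated_convergence (fun u => 2 * ‖(z - u)⁻¹‖)
      (fun N => (integrable_finsetSum _
        fun n _ => (hout n).mul_const _).neg.aestronglyMeasurable)
      (hint.norm.const_mul 2).integrableOn (fun N => ?_) ?_
    · refine (ae_restrict_iff' measurableSet_ball.compl).2 ?_
      filter_upwards [hne] with u hur hu
      rw [Set.mem_compl_iff, mem_ball_zero_iff, not_lt] at hu
      have hu0 : u ≠ 0 := norm_pos_iff.1 (hr.trans_le hu)
      have huz : u ≠ z := by rintro rfl; exact hur hz
      rw [hsum N u hu0 huz]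
      refine norm_one_sub_pow_mul_le ?_ N
      rw [norm_div, hz]
      exact (div_le_one (hr.trans_le hu)).2 hu
    · refine (ae_restrict_iff' measurableSet_ball.compl).2 ?_
      filter_upwards [hne] with u hur hu
      rw [Set.mem_compl_iff, mem_ball_zero_iff, not_lt] at hu
      have hu0 : u ≠ 0 := norm_pos_iff.1 (hr.trans_le hu)
      have huz : u ≠ z := by rintro rfl; exact hur hz
      simp_rw [fun N => hsum N u hu0 huz]
      refine tendsto_one_sub_pow_mul _ ?_
      rw [norm_div, hz]
      exact (div_lt_one (hr.trans_le hu)).2 (lt_of_le_of_ne hu hur.symm)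

lemma norm_innerMoment_le {ω : Measure ℂ} {c α : ℝ} (hc : 0 < c) (hα : 0 < α)
    (hω : ∀ r > (0 : ℝ), ω (ball (0 : ℂ) r) = ENNReal.ofReal (c * r ^ α)) {r : ℝ} (hr : 0 < r)
    (n : ℕ) : ‖innerMoment ω r n‖ ≤ c * α * (r ^ (n + α) / (n + α)) := by
  have h := enorm_integral_le_lintegral_enorm (μ := ω.restrict (ball (0 : ℂ) r)) (fun u : ℂ => u ^ n)
  rw [lintegral_ball_pow hc hα hω hr, ← ofReal_norm] at h
  exact (ENNReal.ofReal_le_ofReal_iff (by positivity)).1 h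

lemma norm_outerMoment_le {ω : Measure ℂ} {c α : ℝ} (hc : 0 < c) (hα : α ∈ Set.Ioo (0 : ℝ) 1)
    (hω : ∀ r > (0 : ℝ), ω (ball (0 : ℂ) r) = ENNReal.ofReal (c * r ^ α)) {r : ℝ} (hr : 0 < r)
    (n : ℕ) : ‖outerMoment ω r (n + 1)‖ ≤ c * α * (r ^ (α - (n + 1)) / (n + 1 - α)) := by
  have h := enorm_integral_le_lintegral_enorm (μ := ω.restrict (ball (0 : ℂ) r)ᶜ)
    (fun u : ℂ => u ^ (-((n + 1 : ℕ) : ℤ)))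
  rw [lintegral_ball_compl_zpow hc hα hω hr, ← ofReal_norm] at h
  refine (ENNReal.ofReal_le_ofReal_iff ?_).1 h
  have h1 := hα.1
  have h2 : 0 ≤ n + 1 - α := by have := hα.2; have : (0 : ℝ) ≤ n := n.cast_nonneg; linarith
  positivity

lemma integral_norm_sq_laurentSum_le {ω : Measure ℂ} {c α : ℝ} (hc : 0 < c)
    (hα : α ∈ Set.Ioo (0 : ℝ) 1)
    (hω : ∀ r > (0 : ℝ), ω (ball (0 : ℂ) r) = ENNReal.ofReal (c * r ^ α)) {r : ℝ} (hr : 0 < r)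
    (N : ℕ) :
    ∫ θ in (-π)..π, ‖laurentSum ω r N (circleMap 0 r θ)‖ ^ 2 ≤
      2 * π * (c * α * r ^ (α - 1)) ^ 2 * (π ^ 2 / Real.sin (π * α) ^ 2) := by
  have hα0 := hα.1
  let f : ℕ ⊕ ℕ → ℤ := Sum.elim (fun n => -((n : ℤ) + 1)) (fun n => n)
  let a : ℕ ⊕ ℕ → ℂ := Sum.elim (fun n => innerMoment ω r n * ((r : ℂ) ^ (n + 1))⁻¹)
    (fun n => -(outerMoment ω r (n + 1) * (r : ℂ) ^ n))
  have hf : Function.Injective f := by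
    rintro (m | m) (n | n) h <;> simp only [f, Sum.elim_inl, Sum.elim_inr] at h
    · congr 1; omega
    · omega
    · omega
    · congr 1; omega
  let s : Finset (ℕ ⊕ ℕ) := (Finset.range N).disjSum (Finset.range N)
  have hP : ∀ θ : ℝ, laurentSum ω r N (circleMap 0 r θ) =
      ∑ i ∈ s, a i * Complex.exp (f i * θ * Complex.I) := by
    intro θ
    rw [Finset.sum_disjSum]
    simp only [laurentSum, a, f, Sum.elim_inl, Sum.elim_inr, circleMap, zero_add, mul_pow,
      ← Complex.exp_nat_mul, mul_inv, ← Complex.exp_neg, sub_eq_add_neg, ← Finset.sum_neg_distrib]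
    congr 1 <;> refine Finset.sum_congr rfl fun n _ => ?_
    · rw [mul_assoc]
      congr 3
      push_cast
      ring
    · rw [neg_mul, mul_assoc]
      congr 4
      push_cast
      ring
  simp_rw [hP]
  rw [integral_norm_sq_trigPoly s a hf, mul_assoc (2 * π)]
  refine mul_le_mul_of_nonneg_left ?_ (by positivity)
  have hg : Function.Injective fun i => f i + 1 := fun i j h => hf (add_right_cancel h)
  refine le_trans ?_ (mul_le_mul_of_nonneg_left (sum_inv_sq_le s hg hα) (sq_nonneg _))
  rw [Finset.mul_sum]
  refine Finset.sum_le_sum fun i _ => ?_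
  rw [← mul_pow]
  refine sq_le_sq.2 ?_
  rw [abs_norm, abs_mul, abs_of_pos (by positivity : 0 < c * α * r ^ (α - 1))]
  rcases i with n | n
  · simp only [a, f, Sum.elim_inl]
    have h1 : |1 / (α - ((-((n : ℤ) + 1) + 1 : ℤ) : ℝ))| = 1 / (n + α) := by
      rw [abs_of_pos] <;> push_cast
      · ring_nf
      · rw [show α - (-((n : ℝ) + 1) + 1) = n + α by ring]; positivity
    rw [h1, norm_mul, norm_inv, norm_pow, Complex.norm_real, Real.norm_of_nonneg hr.le]
    refine (mul_le_mul_of_nonneg_right (norm_innerMoment_le hc hα0 hω hr n)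
      (by positivity)).trans_eq ?_
    rw [show (n : ℝ) + α = (α - 1) + (n + 1 : ℕ) by push_cast; ring, Real.rpow_add hr,
      Real.rpow_natCast]
    field_simp
  · simp only [a, f, Sum.elim_inr]
    have h2 : 0 < n + 1 - α := by have := hα.2; have : (0 : ℝ) ≤ n := n.cast_nonneg; linarith
    have h1 : |1 / (α - (((n : ℤ) + 1 : ℤ) : ℝ))| = 1 / (n + 1 - α) := by
      rw [abs_div, abs_one, abs_sub_comm]
      push_cast
      rw [abs_of_pos h2]
    rw [h1, norm_neg, norm_mul, norm_pow, Complex.norm_real, Real.norm_of_nonneg hr.le]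
    refine (mul_le_mul_of_nonneg_right (norm_outerMoment_le hc hα hω hr n)
      (by positivity)).trans_eq ?_
    rw [show α - ((n : ℝ) + 1) = (α - 1) - (n : ℕ) by ring, Real.rpow_sub hr,
      Real.rpow_natCast]
    field_simp

lemma continuous_laurentSum_circleMap (ω : Measure ℂ) {r : ℝ} (hr : 0 < r) (N : ℕ) :
    Continuous fun θ => laurentSum ω r N (circleMap 0 r θ) := by
  have h : ∀ n θ, circleMap 0 r θ ^ (n + 1) ≠ 0 := fun n θ =>
    pow_ne_zero _ (circleMap_ne_center hr.ne')
  unfold laurentSum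
  refine Continuous.sub ?_ (by fun_prop)
  exact continuous_finsetSum _ fun n _ => continuous_const.mul
    (((continuous_circleMap 0 r).pow _).inv₀ (h n))

lemma lintegral_cauchyTransform_circle_le {ω : Measure ℂ} {c α : ℝ} (hc : 0 < c)
    (hα : α ∈ Set.Ioo (0 : ℝ) 1)
    (hω : ∀ r > (0 : ℝ), ω (ball (0 : ℂ) r) = ENNReal.ofReal (c * r ^ α)) {r : ℝ} (hr : 0 < r) :
    ∫⁻ θ in Set.Ioc (-π) π, ‖∫ u, (circleMap 0 r θ - u)⁻¹ ∂ω‖ₑ ^ 2 ≤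
      ENNReal.ofReal
        (2 * π * (c * α * r ^ (α - 1)) ^ 2 * (π ^ 2 / Real.sin (π * α) ^ 2)) := by
  have hsph := measure_sphere_eq_zero hc hα.1 hω r
  have hin : ∀ n : ℕ, IntegrableOn (fun u : ℂ => u ^ n) (ball (0 : ℂ) r) ω := by
    refine fun n => ⟨(by fun_prop : Measurable _).aestronglyMeasurable, ?_⟩
    rw [HasFiniteIntegral, lintegral_ball_pow hc hα.1 hω hr]
    exact ENNReal.ofReal_lt_top
  have hout : ∀ n : ℕ,
      IntegrableOn (fun u : ℂ => u ^ (-((n + 1 : ℕ) : ℤ))) (ball (0 : ℂ) r)ᶜ ω := by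
    refine fun n => ⟨(by fun_prop : Measurable _).aestronglyMeasurable, ?_⟩
    rw [HasFiniteIntegral, lintegral_ball_compl_zpow hc hα hω hr]
    exact ENNReal.ofReal_lt_top
  calc ∫⁻ θ in Set.Ioc (-π) π, ‖∫ u, (circleMap 0 r θ - u)⁻¹ ∂ω‖ₑ ^ 2
      ≤ ∫⁻ θ in Set.Ioc (-π) π,
          liminf (fun N => ‖laurentSum ω r N (circleMap 0 r θ)‖ₑ ^ 2) atTop := by
        refine lintegral_mono fun θ => ?_
        by_cases hint : Integrable (fun u : ℂ => (circleMap 0 r θ - u)⁻¹) ω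
        · have hz : ‖circleMap 0 r θ‖ = r := by simp [abs_of_pos hr]
          have := tendsto_laurentSum hr hsph hin hout hz hint
          exact (((ENNReal.continuous_pow 2).tendsto _).comp this.enorm).liminf_eq.ge
        · simp [integral_undef hint]
    _ ≤ liminf (fun N => ∫⁻ θ in Set.Ioc (-π) π,
          ‖laurentSum ω r N (circleMap 0 r θ)‖ₑ ^ 2) atTop :=
        lintegral_liminf_le fun N =>
          ((continuous_laurentSum_circleMap ω hr N).enorm.measurable.pow_const 2)
    _ ≤ _ := by
        refine liminf_le_of_le (by isBoundedDefault) fun b hb => ?_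
        obtain ⟨N, hN⟩ := hb.exists
        refine hN.trans ?_
        have hcont : Continuous fun θ => ‖laurentSum ω r N (circleMap 0 r θ)‖ ^ 2 :=
          (continuous_laurentSum_circleMap ω hr N).norm.pow 2
        simp_rw [← ofReal_norm, ← ENNReal.ofReal_pow (norm_nonneg _)]
        rw [← ofReal_integral_eq_lintegral_ofReal (hcont.intervalIntegrable (-π) π).1
          (ae_of_all _ fun θ => sq_nonneg _),
          ← intervalIntegral.integral_of_le (by linarith [Real.pi_pos])]
        exact ENNReal.ofReal_le_ofReal (integral_norm_sq_laurentSum_le hc hα hω hr N)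

lemma lintegral_ball_eq_circle {f : ℂ → ℝ≥0∞} (hf : Measurable f) (R : ℝ) :
    ∫⁻ z in ball (0 : ℂ) R, f z =
      ∫⁻ ρ in Set.Ioo 0 R, ENNReal.ofReal ρ * ∫⁻ θ in Set.Ioc (-π) π, f (circleMap 0 ρ θ) := by
  have hcm : Continuous fun p : ℝ × ℝ => circleMap 0 p.1 p.2 := by
    unfold circleMap
    fun_prop
  have hpol : ∀ p : ℝ × ℝ, Complex.polarCoord.symm p = circleMap 0 p.1 p.2 := by
    intro p
    rw [Complex.polarCoord_symm_apply, circleMap, zero_add, Complex.exp_mul_I]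
    simp
  have hind : Measurable ((ball (0 : ℂ) R).indicator f) := hf.indicator measurableSet_ball
  rw [← lintegral_indicator measurableSet_ball, ← Complex.lintegral_comp_polarCoord_symm,
    polarCoord_target, Measure.volume_eq_prod, ← Measure.prod_restrict]
  simp_rw [hpol]
  have hm : Measurable fun p : ℝ × ℝ =>
      ENNReal.ofReal p.1 • (ball (0 : ℂ) R).indicator f (circleMap 0 p.1 p.2) :=
    (by fun_prop : Measurable fun p : ℝ × ℝ => ENNReal.ofReal p.1).mul
      (hind.comp hcm.measurable)
  rw [lintegral_prod _ hm.aemeasurable, ← Set.Ioi_inter_Iio (a := (0 : ℝ)) (b := R), Set.inter_comm,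
    ← Measure.restrict_restrict measurableSet_Iio, ← lintegral_indicator measurableSet_Iio]
  refine setLIntegral_congr_fun measurableSet_Ioi fun ρ hρ => ?_
  have hρ0 : 0 < ρ := hρ
  have hm' : Measurable fun θ => (ball (0 : ℂ) R).indicator f (circleMap 0 ρ θ) :=
    hind.comp (continuous_circleMap 0 ρ).measurable
  simp only [smul_eq_mul]
  rw [lintegral_const_mul _ hm',
    restrict_Ioo_eq_restrict_Ioc]
  by_cases h : ρ < R
  · rw [Set.indicator_of_mem (by exact h)]
    congr 2
    funext θ
    rw [Set.indicator_of_mem]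
    simpa [abs_of_pos hρ0] using h
  · rw [Set.indicator_of_notMem (by exact h)]
    have : ∀ θ, (ball (0 : ℂ) R).indicator f (circleMap 0 ρ θ) = 0 := by
      intro θ
      rw [Set.indicator_of_notMem]
      simpa [abs_of_pos hρ0] using h
    simp [this]

lemma lintegral_ball_enorm_inv_lt_top : ∫⁻ z in ball (0 : ℂ) 1, ‖z⁻¹‖ₑ < ∞ := by
  rw [lintegral_ball_eq_circle (by fun_prop)]
  calc _ ≤ ∫⁻ ρ in Set.Ioo (0 : ℝ) 1, volume (Set.Ioc (-π) π) := by
        refine setLIntegral_mono measurable_const fun ρ hρ => ?_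
        have hρ0 : 0 < ρ := hρ.1
        have : ∀ θ, ‖(circleMap 0 ρ θ)⁻¹‖ₑ = (ENNReal.ofReal ρ)⁻¹ := by
          intro θ
          rw [← ofReal_norm, norm_inv, norm_circleMap_zero, abs_of_pos hρ0,
            ENNReal.ofReal_inv_of_pos hρ0]
        simp_rw [this]
        rw [setLIntegral_const, ← mul_assoc,
          ENNReal.mul_inv_cancel (ENNReal.ofReal_pos.2 hρ0).ne' ENNReal.ofReal_ne_top, one_mul]
    _ < ∞ := by
        rw [setLIntegral_const]
        exact ENNReal.mul_lt_top (by simp) (by simp)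

lemma lintegral_ball_enorm_inv_sub_le (u : ℂ) (R : ℝ) :
    ∫⁻ z in ball (0 : ℂ) R, ‖(z - u)⁻¹‖ₑ ≤
      (∫⁻ z in ball (0 : ℂ) 1, ‖z⁻¹‖ₑ) + volume (ball (0 : ℂ) R) := by
  have hm : Measurable ((ball (0 : ℂ) 1).indicator fun z => ‖z⁻¹‖ₑ) :=
    (by fun_prop : Measurable fun z : ℂ => ‖z⁻¹‖ₑ).indicator measurableSet_ball
  calc ∫⁻ z in ball (0 : ℂ) R, ‖(z - u)⁻¹‖ₑ
      ≤ ∫⁻ z in ball (0 : ℂ) R, ((ball (0 : ℂ) 1).indicator (fun z => ‖z⁻¹‖ₑ) (z - u) + 1) := by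
        refine lintegral_mono fun z => ?_
        dsimp only
        by_cases h : z - u ∈ ball (0 : ℂ) 1
        · rw [Set.indicator_of_mem h]
          exact le_self_add
        · rw [Set.indicator_of_notMem h, zero_add, ← ofReal_norm, norm_inv]
          rw [mem_ball_zero_iff, not_lt] at h
          exact ENNReal.ofReal_le_one.2 (inv_le_one_of_one_le₀ h)
    _ = (∫⁻ z in ball (0 : ℂ) R, (ball (0 : ℂ) 1).indicator (fun z => ‖z⁻¹‖ₑ) (z - u)) +
          volume (ball (0 : ℂ) R) := by
        rw [lintegral_add_right _ measurable_const, setLIntegral_one]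
    _ ≤ _ := by
        refine add_le_add_left ?_ _
        refine (setLIntegral_le_lintegral _ _).trans_eq ?_
        rw [lintegral_sub_right_eq_self, lintegral_indicator measurableSet_ball]

lemma lintegral_lintegral_enorm_inv_sub_lt_top {ω : Measure ℂ} {c α : ℝ} (hc : 0 < c)
    (hα : α ∈ Set.Ioo (0 : ℝ) 1)
    (hω : ∀ r > (0 : ℝ), ω (ball (0 : ℂ) r) = ENNReal.ofReal (c * r ^ α)) {R : ℝ} (hR : 0 < R) :
    ∫⁻ u, (∫⁻ z in ball (0 : ℂ) R, ‖(z - u)⁻¹‖ₑ) ∂ω < ∞ := by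
  rw [← lintegral_add_compl _ (measurableSet_ball (x := (0 : ℂ)) (ε := 2 * R))]
  refine ENNReal.add_lt_top.2 ⟨?_, ?_⟩
  · refine (lintegral_mono fun u => lintegral_ball_enorm_inv_sub_le u R).trans_lt ?_
    rw [setLIntegral_const, hω _ (by positivity)]
    exact ENNReal.mul_lt_top
      (ENNReal.add_lt_top.2 ⟨lintegral_ball_enorm_inv_lt_top, measure_ball_lt_top⟩)
      ENNReal.ofReal_lt_top
  · calc ∫⁻ u in (ball (0 : ℂ) (2 * R))ᶜ, (∫⁻ z in ball (0 : ℂ) R, ‖(z - u)⁻¹‖ₑ) ∂ω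
        ≤ ∫⁻ u in (ball (0 : ℂ) (2 * R))ᶜ,
            (2 * volume (ball (0 : ℂ) R)) * ‖u ^ (-((0 + 1 : ℕ) : ℤ))‖ₑ ∂ω := by
          refine setLIntegral_mono (by fun_prop) fun u hu => ?_
          rw [Set.mem_compl_iff, mem_ball_zero_iff, not_lt] at hu
          have hle : ∀ z ∈ ball (0 : ℂ) R, ‖(z - u)⁻¹‖ₑ ≤ 2 * ‖u ^ (-((0 + 1 : ℕ) : ℤ))‖ₑ := by
            intro z hz
            rw [mem_ball_zero_iff] at hz
            have h1 : ‖u‖ / 2 ≤ ‖z - u‖ := by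
              have := norm_sub_norm_le u z
              rw [norm_sub_rev] at this
              linarith
            rw [← ofReal_norm, ← ofReal_norm, ← ENNReal.ofReal_ofNat 2,
              ← ENNReal.ofReal_mul (by norm_num)]
            refine ENNReal.ofReal_le_ofReal ?_
            rw [zero_add, Nat.cast_one, zpow_neg_one, norm_inv, norm_inv]
            calc ‖z - u‖⁻¹ ≤ (‖u‖ / 2)⁻¹ := inv_anti₀ (by linarith) h1
              _ = 2 * ‖u‖⁻¹ := by rw [inv_div, div_eq_mul_inv]
          refine (setLIntegral_mono measurable_const hle).trans_eq ?_
          rw [setLIntegral_const]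
          ring
      _ < ∞ := by
          rw [lintegral_const_mul _ (by fun_prop),
            lintegral_ball_compl_zpow hc hα hω (by positivity)]
          exact ENNReal.mul_lt_top (ENNReal.mul_lt_top (by simp) measure_ball_lt_top)
            ENNReal.ofReal_lt_top

lemma ae_lintegral_circle_lt_top {ω : Measure ℂ} [SigmaFinite ω] {c α : ℝ} (hc : 0 < c)
    (hα : α ∈ Set.Ioo (0 : ℝ) 1)
    (hω : ∀ r > (0 : ℝ), ω (ball (0 : ℂ) r) = ENNReal.ofReal (c * r ^ α)) {R : ℝ} (hR : 0 < R) :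
    ∀ᵐ ρ ∂volume.restrict (Set.Ioo 0 R),
      ∫⁻ θ in Set.Ioc (-π) π, ∫⁻ u, ‖(circleMap 0 ρ θ - u)⁻¹‖ₑ ∂ω < ∞ := by
  have hcm : Continuous fun p : ℝ × ℝ => circleMap 0 p.1 p.2 := by
    unfold circleMap
    fun_prop
  have hk : Measurable fun p : ℂ × ℂ => ‖(p.1 - p.2)⁻¹‖ₑ := by fun_prop
  have hG : Measurable fun z : ℂ => ∫⁻ u, ‖(z - u)⁻¹‖ₑ ∂ω := hk.lintegral_prod_right'
  have h := lintegral_lintegral_enorm_inv_sub_lt_top hc hα hω hR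
  rw [lintegral_lintegral_swap
    (by fun_prop : Measurable fun p : ℂ × ℂ => ‖(p.2 - p.1)⁻¹‖ₑ).aemeasurable,
    lintegral_ball_eq_circle hG] at h
  have hm : Measurable fun ρ : ℝ => ENNReal.ofReal ρ *
      ∫⁻ θ in Set.Ioc (-π) π, ∫⁻ u, ‖(circleMap 0 ρ θ - u)⁻¹‖ₑ ∂ω :=
    (by fun_prop : Measurable fun ρ : ℝ => ENNReal.ofReal ρ).mul
      (hG.comp hcm.measurable).lintegral_prod_right'
  filter_upwards [ae_lt_top hm h.ne, ae_restrict_mem measurableSet_Ioo] with ρ h1 h2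
  exact ENNReal.lt_top_of_mul_ne_top_right h1.ne (ENNReal.ofReal_pos.2 h2.1).ne'

lemma integral_circleMap_mul_inv_sub {r : ℝ} (hr : 0 < r) {u : ℂ} (hu : ‖u‖ ≠ r) :
    ∫ θ in Set.Ioc (-π) π, circleMap 0 r θ * (circleMap 0 r θ - u)⁻¹ =
      (ball (0 : ℂ) r).indicator (fun _ => (2 * π : ℂ)) u := by
  have hper : Function.Periodic (fun θ => circleMap 0 r θ * (circleMap 0 r θ - u)⁻¹) (2 * π) := by
    intro θ
    simp only [periodic_circleMap 0 r θ]
  have h1 : ∫ θ in Set.Ioc (-π) π, circleMap 0 r θ * (circleMap 0 r θ - u)⁻¹ =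
      ∫ θ in (0)..(2 * π), circleMap 0 r θ * (circleMap 0 r θ - u)⁻¹ := by
    rw [← intervalIntegral.integral_of_le (by linarith [Real.pi_pos])]
    have := hper.intervalIntegral_add_eq (-π) 0
    rwa [zero_add, show -π + 2 * π = π by ring] at this
  have h2 : (∮ z in C(0, r), (z - u)⁻¹) =
      Complex.I * ∫ θ in (0)..(2 * π), circleMap 0 r θ * (circleMap 0 r θ - u)⁻¹ := by
    rw [circleIntegral, ← intervalIntegral.integral_const_mul]
    congr 1
    funext θ
    rw [deriv_circleMap, smul_eq_mul]
    ring
  rw [h1]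
  apply mul_left_cancel₀ Complex.I_ne_zero
  rw [← h2]
  by_cases h : u ∈ ball (0 : ℂ) r
  · rw [circleIntegral.integral_sub_inv_of_mem_ball h, Set.indicator_of_mem h]
    ring
  · rw [Set.indicator_of_notMem h, mul_zero]
    have hlt : r < ‖u‖ := by
      rw [mem_ball_zero_iff, not_lt] at h
      exact lt_of_le_of_ne h hu.symm
    refine DiffContOnCl.circleIntegral_eq_zero hr.le (DifferentiableOn.diffContOnCl fun z hz => ?_)
    have hz' : ‖z‖ ≤ r := by
      rw [closure_ball _ hr.ne'] at hz
      simpa using hz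
    have hne : z - u ≠ 0 := sub_ne_zero.2 (by rintro rfl; linarith)
    exact ((differentiableAt_id.sub_const u).inv hne).differentiableWithinAt

lemma ofReal_le_lintegral_cauchyTransform_circle {ω : Measure ℂ} [SigmaFinite ω] {r m : ℝ}
    (hr : 0 < r) (hm : 0 ≤ m) (hball : ω (ball (0 : ℂ) r) = ENNReal.ofReal m)
    (hsph : ω (sphere (0 : ℂ) r) = 0)
    (hfin : ∫⁻ θ in Set.Ioc (-π) π, ∫⁻ u, ‖(circleMap 0 r θ - u)⁻¹‖ₑ ∂ω < ∞) :
    ENNReal.ofReal (2 * π * (m / r) ^ 2) ≤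
      ∫⁻ θ in Set.Ioc (-π) π, ‖∫ u, (circleMap 0 r θ - u)⁻¹ ∂ω‖ₑ ^ 2 := by
  have hcm : Continuous (circleMap 0 r) := continuous_circleMap 0 r
  have hmeas : Measurable fun p : ℝ × ℂ => (circleMap 0 r p.1 - p.2)⁻¹ := by
    have := hcm.measurable
    fun_prop
  have hcauchy : StronglyMeasurable fun θ => ∫ u, (circleMap 0 r θ - u)⁻¹ ∂ω :=
    hmeas.stronglyMeasurable.integral_prod_right'
  have hne : ∀ᵐ u ∂ω, ‖u‖ ≠ r := by
    rw [ae_iff]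
    convert hsph using 2
    ext u
    simp
  have hint : Integrable (fun p : ℝ × ℂ => circleMap 0 r p.1 * (circleMap 0 r p.1 - p.2)⁻¹)
      ((volume.restrict (Set.Ioc (-π) π)).prod ω) := by
    have h0 : Integrable (fun p : ℝ × ℂ => (circleMap 0 r p.1 - p.2)⁻¹)
        ((volume.restrict (Set.Ioc (-π) π)).prod ω) := by
      refine ⟨hmeas.aestronglyMeasurable, ?_⟩
      rw [HasFiniteIntegral, lintegral_prod _ hmeas.enorm.aemeasurable]
      exact hfin
    refine h0.bdd_mul (c := r) (hcm.comp continuous_fst).aestronglyMeasurable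
      (ae_of_all _ fun p => ?_)
    simp [abs_of_pos hr]
  have hval : ∫ θ in Set.Ioc (-π) π, circleMap 0 r θ * ∫ u, (circleMap 0 r θ - u)⁻¹ ∂ω =
      ((2 * π * m : ℝ) : ℂ) := by
    simp_rw [← integral_const_mul]
    rw [integral_integral_swap hint,
      integral_congr_ae (hne.mono fun u hu => integral_circleMap_mul_inv_sub hr hu),
      integral_indicator measurableSet_ball, setIntegral_const, measureReal_def, hball,
      ENNReal.toReal_ofReal hm, Complex.real_smul]
    push_cast
    ring
  have h1 : ENNReal.ofReal (2 * π * (m / r)) ≤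
      ∫⁻ θ in Set.Ioc (-π) π, ‖∫ u, (circleMap 0 r θ - u)⁻¹ ∂ω‖ₑ := by
    have h := enorm_integral_le_lintegral_enorm (μ := volume.restrict (Set.Ioc (-π) π))
      (fun θ => circleMap 0 r θ * ∫ u, (circleMap 0 r θ - u)⁻¹ ∂ω)
    have hc : ∀ θ, ‖circleMap 0 r θ‖ₑ = ENNReal.ofReal r := by
      intro θ
      rw [← ofReal_norm, norm_circleMap_zero, abs_of_pos hr]
    simp_rw [enorm_mul, hc] at h
    rw [hval, lintegral_const_mul _ hcauchy.measurable.enorm, ← ofReal_norm, Complex.norm_real,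
      Real.norm_of_nonneg (by positivity)] at h
    rw [← mul_div_assoc, ENNReal.ofReal_div_of_pos hr]
    exact ENNReal.div_le_of_le_mul' h
  have hCS := ENNReal.lintegral_mul_le_Lp_mul_Lq (volume.restrict (Set.Ioc (-π) π))
    Real.HolderConjugate.two_two hcauchy.measurable.enorm.aemeasurable
    (aemeasurable_const (b := (1 : ℝ≥0∞)))
  simp only [Pi.mul_apply, mul_one, ENNReal.rpow_two] at hCS
  have h2 := pow_le_pow_left₀ (zero_le) (h1.trans hCS) 2
  rw [mul_pow, ← ENNReal.rpow_natCast, ← ENNReal.rpow_natCast, ← ENNReal.rpow_natCast,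
    ← ENNReal.rpow_mul, ← ENNReal.rpow_mul] at h2
  norm_num at h2
  rw [← ENNReal.ofReal_pow (by positivity), mul_comm] at h2
  have hpi : (0 : ℝ) < π + π := by positivity
  have h3 := ENNReal.div_le_of_le_mul h2
  rw [← ENNReal.ofReal_div_of_pos hpi] at h3
  refine le_trans (le_of_eq ?_) h3
  congr 1
  field_simp
  ring

lemma localEnergy_eq (ω : Measure ℂ) [SigmaFinite ω] (r : ℝ) :
    localEnergy ω r = ∫⁻ ρ in Set.Ioo 0 r, ENNReal.ofReal (ρ * (2 * π)⁻¹ ^ 2) *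
      ∫⁻ θ in Set.Ioc (-π) π, ‖∫ u, (circleMap 0 ρ θ - u)⁻¹ ∂ω‖ₑ ^ 2 := by
  have hk : Measurable fun p : ℂ × ℂ => (p.1 - p.2)⁻¹ := by fun_prop
  have hF : Measurable fun z : ℂ => ‖∫ u, (z - u)⁻¹ ∂ω‖ₑ ^ 2 :=
    (hk.stronglyMeasurable.integral_prod_right').measurable.enorm.pow_const 2
  have h : ∀ z, (‖biotSavart ω z‖₊ : ℝ≥0∞) ^ 2 =
      ENNReal.ofReal ((2 * π)⁻¹ ^ 2) * ‖∫ u, (z - u)⁻¹ ∂ω‖ₑ ^ 2 := by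
    intro z
    rw [← enorm_eq_nnnorm, ← ofReal_norm, norm_biotSavart, ENNReal.ofReal_mul (by positivity),
      ofReal_norm, mul_pow, ENNReal.ofReal_pow (by positivity)]
  unfold localEnergy
  simp_rw [h]
  rw [lintegral_ball_eq_circle (hF.const_mul _)]
  refine setLIntegral_congr_fun measurableSet_Ioo fun ρ hρ => ?_
  have hρ0 : 0 < ρ := hρ.1
  have hm : Measurable fun θ => ‖∫ u, (circleMap 0 ρ θ - u)⁻¹ ∂ω‖ₑ ^ 2 :=
    hF.comp (continuous_circleMap 0 ρ).measurable
  rw [lintegral_const_mul _ hm, ← mul_assoc,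
    ENNReal.ofReal_mul hρ0.le]

/-- Theorem 1.1 (main theorem): two-sided bound on the local kinetic energy for a
nonnegative σ-finite vorticity measure with `ω(B(0,r)) = c·r^α`, `α ∈ (0,1)`. -/
theorem stmt0 (ω : Measure ℂ) [SigmaFinite ω] (c α : ℝ) (hc : 0 < c)
    (hα : α ∈ Set.Ioo (0 : ℝ) 1)
    (hω : ∀ r > (0 : ℝ), ω (ball (0 : ℂ) r) = ENNReal.ofReal (c * r ^ α)) :
    ∀ r > (0 : ℝ),
      ENNReal.ofReal (c ^ 2 / (4 * π * α) * r ^ (2 * α)) ≤ localEnergy ω r ∧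
      localEnergy ω r ≤
        ENNReal.ofReal (c ^ 2 * α * π / (4 * Real.sin (π * α) ^ 2) * r ^ (2 * α)) := by
  intro r hr
  have hα0 := hα.1
  have hexp : (-1 : ℝ) < 2 * α - 1 := by linarith
  have hrpow : ∀ ρ : ℝ, 0 < ρ → ρ * (ρ ^ (α - 1)) ^ 2 = ρ ^ (2 * α - 1) := by
    intro ρ hρ
    nth_rewrite 1 [← Real.rpow_one ρ]
    rw [← Real.rpow_natCast, ← Real.rpow_mul hρ.le, ← Real.rpow_add hρ]
    congr 1
    push_cast
    ring
  have hsin : 0 < Real.sin (π * α) :=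
    Real.sin_pos_of_pos_of_lt_pi (by positivity) (by have := hα.2; nlinarith [Real.pi_pos])
  rw [localEnergy_eq]
  constructor
  · have h := lintegral_Ioo_ofReal_mul_rpow (A := c ^ 2 / (2 * π)) (by positivity) hexp hr.le
    rw [sub_add_cancel] at h
    refine le_of_eq_of_le ?_ (h.symm.le.trans (lintegral_mono_ae ?_))
    · congr 1
      field_simp
      norm_num
    · filter_upwards [ae_lintegral_circle_lt_top hc hα hω hr, ae_restrict_mem measurableSet_Ioo]
        with ρ hfin hρ
      have hρ0 : 0 < ρ := hρ.1
      refine le_trans (le_of_eq ?_) (mul_le_mul_right (ofReal_le_lintegral_cauchyTransform_circle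
        hρ0 (by positivity) (hω ρ hρ0) (measure_sphere_eq_zero hc hα0 hω ρ) hfin) _)
      rw [← ENNReal.ofReal_mul (by positivity), ← hrpow ρ hρ0, Real.rpow_sub_one hρ0.ne']
      congr 1
      field_simp
  · have h := lintegral_Ioo_ofReal_mul_rpow
      (A := (c * α) ^ 2 * π / (2 * Real.sin (π * α) ^ 2)) (by positivity) hexp hr.le
    rw [sub_add_cancel] at h
    refine ((setLIntegral_mono (by fun_prop) fun ρ hρ => ?_).trans h.le).trans_eq ?_
    · have hρ0 : 0 < ρ := hρ.1
      refine (mul_le_mul_right (lintegral_cauchyTransform_circle_le hc hα hω hρ0) _).trans_eq ?_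
      rw [← ENNReal.ofReal_mul (by positivity), ← hrpow ρ hρ0]
      congr 1
      field_simp
    · congr 1
      field_simp
      norm_num
end

section
/- Let ω be a nonnegative σ-finite measure on ℝ² = ℂ satisfying ∫_ℂ (1+|u|)^{−1} dω(u) < ∞, and let v(x) = (1/(2π)) ∫_{ℝ²} (x−y)^⊥/|x−y|² dω(y). Then v ∈ L¹_loc(ℝ²) (in particular v is well-defined almost everywhere), and for every test function φ ∈ C_0^∞(ℝ²) one has ∫_{ℝ²} ∇φ(x)·v(x) dx = 0 and ∫_{ℝ²} (⊥∇φ)(x)·v(x) dx = −∫_{ℝ²} φ(y) dω(y); that is, v is divergence-free in the sense of distributions and curl v = ω in the sense of distributions. -/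
open MeasureTheory Metric Real Filter
open scoped ENNReal NNReal Topology

/-- The kernel `c z / |z|²` on `ℂ`; the Biot-Savart kernel is the case `c = i`, up to `2π`. -/
noncomputable def planarKernel (c z : ℂ) : ℂ :=
  c * z / (((‖z‖ : ℝ) : ℂ) ^ 2)

lemma norm_planarKernel (c z : ℂ) : ‖planarKernel c z‖ = ‖c‖ * ‖z‖⁻¹ := by
  rcases eq_or_ne z 0 with rfl | hz
  · simp [planarKernel]
  · have : ‖z‖ ≠ 0 := norm_ne_zero_iff.2 hz
    simp only [planarKernel, norm_div, norm_mul, norm_pow, Complex.norm_real, norm_norm]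
    field_simp

lemma measurable_planarKernel (c : ℂ) : Measurable (planarKernel c) := by
  unfold planarKernel
  fun_prop

lemma lintegral_ball_inv_norm_lt_top :
    ∫⁻ z in ball (0 : ℂ) 1, ENNReal.ofReal ‖z‖⁻¹ < ⊤ := by
  have h : LocallyIntegrable (fun z : ℂ ↦ ‖z‖⁻¹) volume := by
    refine locallyIntegrable_of_norm_le_rpow (C := 1) (α := 1) (by simp) (by simp)
      (ae_of_all _ fun z ↦ ?_) (by fun_prop)
    simp [Real.rpow_neg_one]
  have h' := (h.integrableOn_isCompact (isCompact_closedBall (0 : ℂ) 1)).mono_set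
    ball_subset_closedBall
  exact h'.lintegral_lt_top

lemma inv_norm_sub_le {R : ℝ} {x u : ℂ} (hx : x ∈ ball (0 : ℂ) R) :
    ‖x - u‖⁻¹ ≤ (1 + ‖u‖)⁻¹ *
      ((2 + R) + (1 + R) * (ball (0 : ℂ) 1).indicator (fun z ↦ ‖z‖⁻¹) (x - u)) := by
  have hxR : ‖x‖ < R := by simpa using hx
  have hR : 0 ≤ R := (norm_nonneg x).trans hxR.le
  have hu : 0 < 1 + ‖u‖ := by positivity
  have h1 : ‖x - u‖⁻¹ ≤ 1 + (ball (0 : ℂ) 1).indicator (fun z ↦ ‖z‖⁻¹) (x - u) := by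
    by_cases h : x - u ∈ ball (0 : ℂ) 1
    · simp [Set.indicator_of_mem h]
    · rw [Set.indicator_of_notMem h, add_zero]
      exact inv_le_one_of_one_le₀ (by simpa using h)
  have h2 : (1 + ‖u‖) * ‖x - u‖⁻¹ ≤ 1 + (1 + R) * ‖x - u‖⁻¹ := by
    have h3 : ‖u‖ ≤ R + ‖x - u‖ := by
      have := norm_sub_le x (x - u)
      rw [sub_sub_cancel] at this
      linarith
    calc (1 + ‖u‖) * ‖x - u‖⁻¹ ≤ (1 + R + ‖x - u‖) * ‖x - u‖⁻¹ := by
          gcongr ?_ * _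
          linarith
      _ = ‖x - u‖ * ‖x - u‖⁻¹ + (1 + R) * ‖x - u‖⁻¹ := by ring
      _ ≤ _ := by gcongr; exact mul_inv_le_one
  rw [← div_eq_inv_mul, le_div_iff₀ hu]
  nlinarith

lemma exists_lintegral_ball_inv_norm_sub_le (R : ℝ) :
    ∃ C : ℝ≥0∞, C ≠ ⊤ ∧ ∀ u : ℂ, ∫⁻ x in ball (0 : ℂ) R, ENNReal.ofReal ‖x - u‖⁻¹ ≤
      C * ENNReal.ofReal (1 + ‖u‖)⁻¹ := by
  set h : ℂ → ℝ := (ball (0 : ℂ) 1).indicator (fun z ↦ ‖z‖⁻¹) with hh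
  have hm : Measurable h :=
    Measurable.indicator (by fun_prop) measurableSet_ball
  have hfin : ∫⁻ z, ENNReal.ofReal (h z) < ⊤ := by
    have : (fun z ↦ ENNReal.ofReal (h z)) =
        (ball (0 : ℂ) 1).indicator fun z ↦ ENNReal.ofReal ‖z‖⁻¹ := by
      ext z
      by_cases hz : z ∈ ball (0 : ℂ) 1 <;> simp [hh, Set.indicator, hz]
    rw [this, lintegral_indicator measurableSet_ball]
    exact lintegral_ball_inv_norm_lt_top
  refine ⟨ENNReal.ofReal (2 + R) * volume (ball (0 : ℂ) R) +
    ENNReal.ofReal (1 + R) * ∫⁻ z, ENNReal.ofReal (h z), ?_, fun u ↦ ?_⟩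
  · exact ENNReal.add_ne_top.2 ⟨ENNReal.mul_ne_top ENNReal.ofReal_ne_top measure_ball_lt_top.ne,
      ENNReal.mul_ne_top ENNReal.ofReal_ne_top hfin.ne⟩
  calc ∫⁻ x in ball (0 : ℂ) R, ENNReal.ofReal ‖x - u‖⁻¹
      ≤ ∫⁻ x in ball (0 : ℂ) R, ENNReal.ofReal (1 + ‖u‖)⁻¹ *
          (ENNReal.ofReal (2 + R) + ENNReal.ofReal (1 + R) * ENNReal.ofReal (h (x - u))) := by
        refine setLIntegral_mono' measurableSet_ball fun x hx ↦ ?_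
        have hR : 0 ≤ R := (norm_nonneg x).trans (by simpa using hx : ‖x‖ < R).le
        rw [← ENNReal.ofReal_mul (by positivity)]
        refine (ENNReal.ofReal_le_ofReal (inv_norm_sub_le hx)).trans ?_
        rw [ENNReal.ofReal_mul (by positivity)]
        gcongr
        exact ENNReal.ofReal_add_le
    _ = ENNReal.ofReal (1 + ‖u‖)⁻¹ * (ENNReal.ofReal (2 + R) * volume (ball (0 : ℂ) R) +
          ENNReal.ofReal (1 + R) * ∫⁻ x in ball (0 : ℂ) R, ENNReal.ofReal (h (x - u))) := by
        rw [lintegral_const_mul _ (by fun_prop), lintegral_add_left (by fun_prop),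
          lintegral_const_mul _ (by fun_prop)]
        simp
    _ ≤ _ := by
        rw [mul_comm]
        gcongr ?_ * _
        gcongr _ + _ * ?_
        refine (setLIntegral_le_lintegral _ _).trans ?_
        rw [lintegral_sub_right_eq_self (fun x ↦ ENNReal.ofReal (h x))]

section

variable {ω : Measure ℂ} [SigmaFinite ω]

lemma integrable_prod_inv_norm_sub (hω : ∫⁻ u, ENNReal.ofReal ((1 + ‖u‖)⁻¹) ∂ω < ⊤) (R : ℝ) :
    Integrable (fun p : ℂ × ℂ ↦ ‖p.1 - p.2‖⁻¹) ((volume.restrict (ball 0 R)).prod ω) := by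
  obtain ⟨C, hC, hle⟩ := exists_lintegral_ball_inv_norm_sub_le R
  have hm : Measurable (fun p : ℂ × ℂ ↦ ‖p.1 - p.2‖⁻¹) := by fun_prop
  refine ⟨hm.aestronglyMeasurable, ?_⟩
  rw [hasFiniteIntegral_iff_ofReal (ae_of_all _ fun p ↦ by positivity),
    lintegral_prod_symm' _ hm.ennreal_ofReal]
  refine (lintegral_mono hle).trans_lt ?_
  rw [lintegral_const_mul _ (by fun_prop)]
  exact ENNReal.mul_lt_top hC.lt_top hω

lemma integrable_prod_planarKernel (hω : ∫⁻ u, ENNReal.ofReal ((1 + ‖u‖)⁻¹) ∂ω < ⊤) (c : ℂ)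
    (R : ℝ) :
    Integrable (fun p : ℂ × ℂ ↦ planarKernel c (p.1 - p.2))
      ((volume.restrict (ball 0 R)).prod ω) := by
  refine ((integrable_prod_inv_norm_sub hω R).const_mul ‖c‖).mono'
    ((measurable_planarKernel c).comp (by fun_prop)).aestronglyMeasurable (ae_of_all _ fun p ↦ ?_)
  rw [norm_planarKernel]

lemma ae_integrable_planarKernel (hω : ∫⁻ u, ENNReal.ofReal ((1 + ‖u‖)⁻¹) ∂ω < ⊤) (c : ℂ) :
    ∀ᵐ x, Integrable (fun u ↦ planarKernel c (x - u)) ω := by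
  have h (n : ℕ) : ∀ᵐ x, x ∈ ball (0 : ℂ) n → Integrable (fun u ↦ planarKernel c (x - u)) ω :=
    (ae_restrict_iff' measurableSet_ball).1 (integrable_prod_planarKernel hω c n).prod_right_ae
  filter_upwards [ae_all_iff.2 h] with x hx
  obtain ⟨n, hn⟩ := exists_nat_gt ‖x‖
  exact hx n (by simpa using hn)

lemma locallyIntegrable_biotSavart (hω : ∫⁻ u, ENNReal.ofReal ((1 + ‖u‖)⁻¹) ∂ω < ⊤) :
    LocallyIntegrable (biotSavart ω) volume := by
  rw [locallyIntegrable_iff]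
  intro K hK
  obtain ⟨R, -, hR⟩ := hK.isBounded.exists_pos_norm_lt
  refine IntegrableOn.mono_set (t := ball 0 R) ?_ fun x hx ↦ by simpa using hR x hx
  exact (integrable_prod_planarKernel hω Complex.I R).integral_prod_left.smul (2 * π)⁻¹

lemma integrable_fderiv_planarKernel (hω : ∫⁻ u, ENNReal.ofReal ((1 + ‖u‖)⁻¹) ∂ω < ⊤)
    {φ : ℂ → ℝ} (hφ : ContDiff ℝ 1 φ) (hc : HasCompactSupport φ) (c : ℂ) :
    Integrable (fun p : ℂ × ℂ ↦ fderiv ℝ φ p.1 (planarKernel c (p.1 - p.2)))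
      (volume.prod ω) := by
  have hd : Continuous (fderiv ℝ φ) := hφ.continuous_fderiv one_ne_zero
  have hdc : HasCompactSupport (fderiv ℝ φ) := hc.fderiv ℝ
  obtain ⟨C, hC⟩ := hd.bounded_above_of_compact_support hdc
  obtain ⟨R, -, hR⟩ := hdc.isCompact.isBounded.exists_pos_norm_lt
  have hm : StronglyMeasurable
      (fun p : ℂ × ℂ ↦ fderiv ℝ φ p.1 (planarKernel c (p.1 - p.2))) :=
    isBoundedBilinearMap_apply.continuous.comp_stronglyMeasurable
      ((hd.comp continuous_fst).stronglyMeasurable.prodMk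
        ((measurable_planarKernel c).comp (by fun_prop)).stronglyMeasurable)
  rw [← integrableOn_iff_integrable_of_support_subset (s := ball (0 : ℂ) R ×ˢ Set.univ),
    IntegrableOn, ← Measure.prod_restrict, Measure.restrict_univ]
  · refine ((integrable_prod_planarKernel hω c R).norm.const_mul C).mono'
      hm.aestronglyMeasurable (ae_of_all _ fun p ↦ ?_)
    exact ((fderiv ℝ φ p.1).le_opNorm _).trans (by gcongr; exact hC _)
  · intro p hp
    refine ⟨?_, trivial⟩
    have : p.1 ∈ tsupport (fderiv ℝ φ) := by
      refine subset_tsupport _ fun h0 ↦ hp ?_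
      simp [h0]
    simpa using hR _ this

lemma integral_fderiv_mul_biotSavart (hω : ∫⁻ u, ENNReal.ofReal ((1 + ‖u‖)⁻¹) ∂ω < ⊤)
    {φ : ℂ → ℝ} (hφ : ContDiff ℝ 1 φ) (hc : HasCompactSupport φ) (c : ℂ) :
    ∫ x, fderiv ℝ φ x (c * biotSavart ω x) =
      (2 * π)⁻¹ * ∫ u, (∫ x, fderiv ℝ φ x (planarKernel (c * Complex.I) (x - u))) ∂ω := by
  rw [← integral_integral_swap (integrable_fderiv_planarKernel hω hφ hc _), ← integral_const_mul]
  refine integral_congr_ae ?_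
  filter_upwards [ae_integrable_planarKernel hω (c * Complex.I)] with x hx
  have hker (u : ℂ) : planarKernel (c * Complex.I) (x - u) =
      c * (Complex.I * (x - u) / (((‖x - u‖ : ℝ) : ℂ) ^ 2)) := by
    simp only [planarKernel, mul_assoc, mul_div_assoc]
  rw [ContinuousLinearMap.integral_comp_comm _ hx]
  simp only [hker]
  rw [integral_const_mul, biotSavart, mul_smul_comm, map_smul, smul_eq_mul]

end

lemma integral_fderiv_planarKernel_sub (φ : ℂ → ℝ) (c u : ℂ) :
    ∫ x, fderiv ℝ φ x (planarKernel c (x - u)) =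
      ∫ x, fderiv ℝ (fun y ↦ φ (y + u)) x (planarKernel c x) := by
  rw [← integral_add_right_eq_self _ u]
  simp [fderiv_comp_add_right]

lemma integral_fderiv_planarKernel_eq_polar (φ : ℂ → ℝ) (c : ℂ) :
    ∫ x, fderiv ℝ φ x (planarKernel c x) =
      ∫ p in Set.Ioi (0 : ℝ) ×ˢ Set.Ioo (-π) π,
        fderiv ℝ φ (p.1 * Complex.exp (p.2 * Complex.I)) (c * Complex.exp (p.2 * Complex.I)) := by
  rw [← Complex.integral_comp_polarCoord_symm]
  refine setIntegral_congr_fun (measurableSet_Ioi.prod measurableSet_Ioo) fun p hp ↦ ?_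
  have hp1 : 0 < p.1 := hp.1
  have hpc : (p.1 : ℂ) ≠ 0 := by exact_mod_cast hp1.ne'
  simp only [Complex.polarCoord_symm_apply, Complex.ofReal_cos, Complex.ofReal_sin,
    ← Complex.exp_mul_I]
  rw [← map_smul]
  congr 1
  rw [planarKernel, norm_mul, Complex.norm_exp_ofReal_mul_I, Complex.norm_real, mul_one,
    Real.norm_of_nonneg hp1.le, Complex.real_smul]
  field_simp

lemma integrableOn_fderiv_polar {φ : ℂ → ℝ} (hφ : ContDiff ℝ 1 φ) (hc : HasCompactSupport φ)
    (c : ℂ) :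
    IntegrableOn (fun p : ℝ × ℝ ↦
      fderiv ℝ φ (p.1 * Complex.exp (p.2 * Complex.I)) (c * Complex.exp (p.2 * Complex.I)))
      (Set.Ioi (0 : ℝ) ×ˢ Set.Ioo (-π) π) := by
  have hd : Continuous (fderiv ℝ φ) := hφ.continuous_fderiv one_ne_zero
  have hdc : HasCompactSupport (fderiv ℝ φ) := hc.fderiv ℝ
  obtain ⟨R, -, hR⟩ := hdc.isCompact.isBounded.exists_pos_norm_lt
  have hcont : Continuous (fun p : ℝ × ℝ ↦
      fderiv ℝ φ (p.1 * Complex.exp (p.2 * Complex.I)) (c * Complex.exp (p.2 * Complex.I))) :=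
    (hd.comp (by fun_prop)).clm_apply (by fun_prop)
  refine IntegrableOn.of_forall_sdiff_eq_zero
    (hcont.continuousOn.integrableOn_compact
      ((isCompact_Icc (a := (0 : ℝ)) (b := R)).prod (isCompact_Icc (a := -π) (b := π))))
    (measurableSet_Ioi.prod measurableSet_Ioo) fun p hp ↦ ?_
  have hp1 : 0 < p.1 := hp.1.1
  have hRp : R < p.1 := by
    by_contra! h
    exact hp.2 ⟨⟨hp1.le, h⟩, Set.Ioo_subset_Icc_self hp.1.2⟩
  rw [image_eq_zero_of_notMem_tsupport (f := fderiv ℝ φ)]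
  · simp
  · intro hmem
    have := hR _ hmem
    rw [norm_mul, Complex.norm_exp_ofReal_mul_I, Complex.norm_real, mul_one,
      Real.norm_of_nonneg hp1.le] at this
    linarith

lemma integral_fderiv_planarKernel_I {φ : ℂ → ℝ} (hφ : ContDiff ℝ 1 φ)
    (hc : HasCompactSupport φ) :
    ∫ x, fderiv ℝ φ x (planarKernel Complex.I x) = 0 := by
  have hd : Continuous (fderiv ℝ φ) := hφ.continuous_fderiv one_ne_zero
  rw [integral_fderiv_planarKernel_eq_polar, Measure.volume_eq_prod,
    setIntegral_prod _ (integrableOn_fderiv_polar hφ hc _)]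
  refine setIntegral_eq_zero_of_forall_eq_zero fun r hr ↦ ?_
  have hr0 : r ≠ 0 := (Set.mem_Ioi.1 hr).ne'
  rw [← integral_Ioc_eq_integral_Ioo,
    ← intervalIntegral.integral_of_le (by linarith [Real.pi_pos])]
  have hderiv (θ : ℝ) : HasDerivAt (fun θ : ℝ ↦ r⁻¹ * φ (r * Complex.exp (θ * Complex.I)))
      (fderiv ℝ φ (r * Complex.exp (θ * Complex.I))
        (Complex.I * Complex.exp (θ * Complex.I))) θ := by
    have he : HasDerivAt (fun θ : ℝ ↦ (r : ℂ) * Complex.exp (θ * Complex.I))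
        (r * (Complex.exp (θ * Complex.I) * (1 * Complex.I))) θ :=
      ((((hasDerivAt_id θ).ofReal_comp).mul_const Complex.I).cexp).const_mul _
    have h := (((hφ.differentiable one_ne_zero _).hasFDerivAt.comp_hasDerivAt θ he)).const_mul r⁻¹
    refine h.congr_deriv ?_
    rw [← smul_eq_mul, ← map_smul, Complex.real_smul, Complex.ofReal_inv,
      inv_mul_cancel_left₀ (by exact_mod_cast hr0), one_mul, mul_comm (Complex.exp _)]
  rw [intervalIntegral.integral_eq_sub_of_hasDerivAt (fun θ _ ↦ hderiv θ)]
  · simp [Complex.exp_neg, Complex.exp_pi_mul_I]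
  · exact Continuous.intervalIntegrable
      ((hd.comp (by fun_prop)).clm_apply (by fun_prop)) _ _

lemma integral_Ioi_fderiv_exp {φ : ℂ → ℝ} (hφ : ContDiff ℝ 1 φ) (hc : HasCompactSupport φ)
    (θ : ℝ) :
    ∫ r in Set.Ioi (0 : ℝ), fderiv ℝ φ (r * Complex.exp (θ * Complex.I))
      (Complex.exp (θ * Complex.I)) = -φ 0 := by
  set e := Complex.exp (θ * Complex.I)
  have he : ‖e‖ = 1 := Complex.norm_exp_ofReal_mul_I θ
  have hcd : ContDiff ℝ 1 (fun r : ℝ ↦ φ (r * e)) :=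
    hφ.comp (Complex.ofRealCLM.contDiff.mul contDiff_const)
  obtain ⟨R, -, hR⟩ := hc.isCompact.isBounded.exists_pos_norm_lt
  have hcs : HasCompactSupport (fun r : ℝ ↦ φ (r * e)) := by
    refine HasCompactSupport.intro (isCompact_closedBall (0 : ℝ) R) fun r hr ↦ ?_
    refine image_eq_zero_of_notMem_tsupport fun hmem ↦ hr ?_
    have := hR _ hmem
    rw [norm_mul, he, mul_one, Complex.norm_real] at this
    simpa using this.le
  have hderiv (r : ℝ) : fderiv ℝ φ (r * e) e = deriv (fun r : ℝ ↦ φ (r * e)) r := by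
    have h1 : HasDerivAt (fun r : ℝ ↦ (r : ℂ) * e) (1 * e) r :=
      ((hasDerivAt_id r).ofReal_comp).mul_const e
    have h := (hφ.differentiable one_ne_zero _).hasFDerivAt.comp_hasDerivAt r h1
    rw [one_mul] at h
    exact h.deriv.symm
  simp_rw [hderiv]
  rw [hcs.integral_Ioi_deriv_eq hcd]
  simp

lemma integral_fderiv_planarKernel_one {φ : ℂ → ℝ} (hφ : ContDiff ℝ 1 φ)
    (hc : HasCompactSupport φ) :
    ∫ x, fderiv ℝ φ x (planarKernel 1 x) = -(2 * π) * φ 0 := by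
  have hint := integrableOn_fderiv_polar hφ hc 1
  rw [integral_fderiv_planarKernel_eq_polar]
  rw [IntegrableOn, Measure.volume_eq_prod, ← Measure.prod_restrict] at hint
  rw [Measure.volume_eq_prod, ← Measure.prod_restrict, integral_prod_symm _ hint]
  simp only [one_mul, integral_Ioi_fderiv_exp hφ hc]
  have : (0 : ℝ) ≤ π + π := by positivity
  simp only [integral_const, measureReal_restrict_apply_univ, Real.volume_real_Ioo, smul_eq_mul]
  rw [sub_neg_eq_add, max_eq_left this]
  ring

/-- Theorem 2.1: the Biot-Savart law. The velocity is locally integrable,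
divergence-free in the sense of distributions, and its curl is `ω` in the sense of
distributions. Identifying `ℝ²` with `ℂ`, for a test function `φ` one has
`∇φ(x)·v(x) = Dφ(x)[v(x)]` and `(⊥∇φ)(x)·v(x) = Dφ(x)[-i·v(x)]`. -/
theorem stmt3 (ω : Measure ℂ) [SigmaFinite ω]
    (hω : ∫⁻ u, ENNReal.ofReal ((1 + ‖u‖)⁻¹) ∂ω < ⊤) :
    LocallyIntegrable (biotSavart ω) volume ∧
    ∀ φ : ℂ → ℝ, ContDiff ℝ (⊤ : ℕ∞) φ → HasCompactSupport φ →
      (∫ x, fderiv ℝ φ x (biotSavart ω x) = 0) ∧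
      (∫ x, fderiv ℝ φ x (-Complex.I * biotSavart ω x)) = -∫ y, φ y ∂ω := by
  refine ⟨locallyIntegrable_biotSavart hω, fun φ hφ hc ↦ ?_⟩
  have hφ1 : ContDiff ℝ 1 φ := hφ.of_le (by exact_mod_cast le_top)
  have htr (u : ℂ) : ContDiff ℝ 1 (fun y ↦ φ (y + u)) := hφ1.comp (by fun_prop)
  have htc (u : ℂ) : HasCompactSupport (fun y ↦ φ (y + u)) :=
    hc.comp_homeomorph (Homeomorph.addRight u)
  constructor
  · have h := integral_fderiv_mul_biotSavart hω hφ1 hc 1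
    simp only [one_mul, integral_fderiv_planarKernel_sub,
      integral_fderiv_planarKernel_I (htr _) (htc _)] at h
    simpa using h
  · rw [integral_fderiv_mul_biotSavart hω hφ1 hc]
    simp only [neg_mul, Complex.I_mul_I, neg_neg, integral_fderiv_planarKernel_sub,
      integral_fderiv_planarKernel_one (htr _) (htc _), zero_add]
    rw [integral_neg, integral_const_mul, mul_neg, inv_mul_cancel_left₀ (by positivity)]
end

section
/- Let ω be a nonnegative σ-finite measure on ℝ² = ℂ satisfying ω(B(0,r)) = c·r^α for every r > 0, with c > 0 and α ∈ (0,1). Then v(x) = (1/(2π)) ∫_{ℝ²} (x−y)^⊥/|x−y|² dω(y) belongs to L²_loc(ℝ²), i.e. ∫_{B(0,R)} |v(x)|² dx < ∞ for every R > 0. -/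
open MeasureTheory Metric Real Filter
open scoped ENNReal NNReal Topology

/-- Layer-cake bound for a function in the intersection of two weak Lebesgue spaces. -/
theorem lintegral_ofReal_le_of_weak_bounds {β : Type*} [MeasurableSpace β] (μ : Measure β)
    {f : β → ℝ} (hf : Measurable f) (hf0 : ∀ y, 0 ≤ f y) (C : ℝ≥0∞) (a b : ℝ)
    (ha : ∀ t > 0, μ {y | t < f y} ≤ C * ENNReal.ofReal (t ^ (-a)))
    (hb : ∀ t > 0, μ {y | t < f y} ≤ C * ENNReal.ofReal (t ^ (-b))) :
    ∫⁻ y, ENNReal.ofReal (f y) ∂μ ≤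
      C * ∫⁻ t in Set.Ioi (0 : ℝ), ENNReal.ofReal (min (t ^ (-a)) (t ^ (-b))) := by
  rw [lintegral_eq_lintegral_meas_lt μ (Eventually.of_forall hf0) hf.aemeasurable,
    ← lintegral_const_mul _ (by fun_prop)]
  refine setLIntegral_mono' measurableSet_Ioi fun t ht => ?_
  rcases min_choice (t ^ (-a)) (t ^ (-b)) with h | h <;> rw [h]
  exacts [ha t ht, hb t ht]

theorem lintegral_min_rpow_lt_top {a b : ℝ} (ha : a < 1) (hb : 1 < b) :
    ∫⁻ t in Set.Ioi (0 : ℝ), ENNReal.ofReal (min (t ^ (-a)) (t ^ (-b))) < ⊤ := by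
  rw [← Set.Ioc_union_Ioi_eq_Ioi (zero_le_one : (0 : ℝ) ≤ 1)]
  refine (lintegral_union_le _ _ _).trans_lt (ENNReal.add_lt_top.2 ⟨?_, ?_⟩)
  · have h : IntegrableOn (fun t : ℝ => t ^ (-a)) (Set.Ioc 0 1) := by
      have := intervalIntegral.intervalIntegrable_rpow' (a := 0) (b := 1) (r := -a) (by linarith)
      exact (intervalIntegrable_iff_integrableOn_Ioc_of_le zero_le_one).1 this
    refine (lintegral_mono fun t => ?_).trans_lt h.2
    rw [← ofReal_norm]
    exact ENNReal.ofReal_le_ofReal ((min_le_left _ _).trans (le_abs_self _))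
  · have h : IntegrableOn (fun t : ℝ => t ^ (-b)) (Set.Ioi 1) :=
      integrableOn_Ioi_rpow_of_lt (by linarith) one_pos
    refine (lintegral_mono fun t => ?_).trans_lt h.2
    rw [← ofReal_norm]
    exact ENNReal.ofReal_le_ofReal ((min_le_right _ _).trans (le_abs_self _))

theorem lt_rpow_of_lt_rpow_neg {d t k : ℝ} (hd : 0 ≤ d) (ht : 0 < t) (hk : 0 < k)
    (h : t < d ^ (-k)) : d < t ^ (-k⁻¹) := by
  rcases hd.eq_or_lt with rfl | hd
  · exact rpow_pos_of_pos ht _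
  have := rpow_lt_rpow_of_neg ht h (z := -k⁻¹) (by simpa using hk)
  rwa [← rpow_mul hd.le, neg_mul_neg, mul_inv_cancel₀ hk.ne', rpow_one] at this

/-- A measure with radial growth `c * r ^ α` about the origin satisfies a uniform Morrey bound. -/
theorem measure_ball_le_of_radial_growth {ω : Measure ℂ} {c α : ℝ} (hc : 0 < c)
    (hα : α ∈ Set.Ioo (0 : ℝ) 1)
    (hω : ∀ r > (0 : ℝ), ω (ball (0 : ℂ) r) = ENNReal.ofReal (c * r ^ α)) (x : ℂ) {r : ℝ}
    (hr : 0 < r) : ω (ball x r) ≤ ENNReal.ofReal (c * 2 ^ α) * ENNReal.ofReal (r ^ α) := by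
  obtain ⟨h0, h1⟩ := hα
  have hpos : 0 < ‖x‖ + r := by positivity
  have hsub : ball x r ⊆ ball 0 (‖x‖ + r) := by
    apply ball_subset_ball'
    simp [add_comm]
  rw [← ENNReal.ofReal_mul (by positivity), mul_assoc, ← mul_rpow zero_le_two hr.le]
  rcases le_or_gt ‖x‖ r with h | h
  · refine (measure_mono hsub).trans ?_
    rw [hω _ hpos]
    gcongr
    linarith
  · have hs : 0 < ‖x‖ - r := by linarith
    have hd : ball x r ⊆ ball 0 (‖x‖ + r) \ ball 0 (‖x‖ - r) := fun y hy => by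
      refine ⟨hsub hy, ?_⟩
      have := norm_sub_norm_le x y
      rw [mem_ball, dist_comm, dist_eq_norm] at hy
      simp only [mem_ball, dist_zero_right, not_lt]
      linarith
    refine (measure_mono hd).trans ?_
    rw [measure_sdiff (ball_subset_ball (by linarith)) measurableSet_ball.nullMeasurableSet
      (by rw [hω _ hs]; exact ENNReal.ofReal_ne_top), hω _ hs, hω _ hpos,
      ← ENNReal.ofReal_sub _ (by positivity)]
    apply ENNReal.ofReal_le_ofReal
    have := rpow_add_le_add_rpow hs.le (mul_pos two_pos hr).le h0.le h1.le
    rw [show ‖x‖ - r + 2 * r = ‖x‖ + r by ring] at this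
    nlinarith

theorem rpow_neg_two_le {α d : ℝ} (hα : α ∈ Set.Ioo (0 : ℝ) 1) (hd : 0 ≤ d) :
    d⁻¹ ^ 2 ≤ min (d ^ (-1 : ℝ)) (d ^ (-(α / 2))) *
      (min (d ^ (-1 : ℝ)) (d ^ (-(α / 2))) + if d < 1 then d ^ (-(2 - α / 2)) else 0) := by
  obtain ⟨h0, h1⟩ := hα
  rcases hd.eq_or_lt with rfl | hd
  · rw [inv_zero, zero_pow two_ne_zero]
    split_ifs <;> positivity
  have h2 : d⁻¹ ^ 2 = d ^ (-2 : ℝ) := by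
    rw [rpow_neg hd.le]; simp
  split_ifs with h
  · rw [min_eq_right (rpow_le_rpow_of_exponent_ge hd h.le (by linarith)), mul_add, ← rpow_add hd,
      ← rpow_add hd, h2, show -(α / 2) + -(2 - α / 2) = -2 by ring]
    have := rpow_pos_of_pos hd (-(α / 2) + -(α / 2))
    linarith
  · rw [min_eq_left (rpow_le_rpow_of_exponent_le (not_lt.1 h) (by linarith)), add_zero,
      ← rpow_add hd, h2]
    norm_num

/-- Cauchy-Schwarz for a kernel dominated by a geometric mean. -/
theorem lintegral_sq_le_of_sq_le_mul {β : Type*} [MeasurableSpace β] (μ : Measure β)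
    {k f g : β → ℝ≥0∞} (hf : Measurable f) (hg : Measurable g) (h : ∀ y, k y ^ 2 ≤ f y * g y) :
    (∫⁻ y, k y ∂μ) ^ 2 ≤ (∫⁻ y, f y ∂μ) * ∫⁻ y, g y ∂μ := by
  have hsq : ∀ u : ℝ≥0∞, (u ^ (1 / 2 : ℝ)) ^ (2 : ℝ) = u := fun u => by
    rw [← ENNReal.rpow_mul]; norm_num
  have hk : ∀ y, k y ≤ f y ^ (1 / 2 : ℝ) * g y ^ (1 / 2 : ℝ) := fun y => by
    rw [← ENNReal.mul_rpow_of_nonneg _ _ (by norm_num)]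
    have := ENNReal.rpow_le_rpow (h y) (z := 1 / 2) (by norm_num)
    rwa [← ENNReal.rpow_natCast, ← ENNReal.rpow_mul, show ((2 : ℕ) : ℝ) * (1 / 2) = 1 by norm_num,
      ENNReal.rpow_one] at this
  have hcs := (lintegral_mono hk).trans (ENNReal.lintegral_mul_le_Lp_mul_Lq μ
    (p := 2) (q := 2) ⟨by norm_num, by norm_num, by norm_num⟩
    (hf.pow_const (1 / 2 : ℝ)).aemeasurable (hg.pow_const (1 / 2 : ℝ)).aemeasurable)
  simp only [hsq] at hcs
  calc _ ≤ _ := pow_le_pow_left' hcs 2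
    _ = _ := by rw [mul_pow, ← ENNReal.rpow_ofNat, ← ENNReal.rpow_ofNat, hsq, hsq]

theorem enorm_biotSavart_le (ω : Measure ℂ) (x : ℂ) :
    ‖biotSavart ω x‖ₑ ≤ ∫⁻ u, ENNReal.ofReal ‖x - u‖⁻¹ ∂ω := by
  have h1 : ‖(2 * π)⁻¹‖ₑ ≤ 1 := by
    rw [← ofReal_norm, norm_eq_abs, abs_of_pos (by positivity), ENNReal.ofReal_le_one]
    exact inv_le_one_of_one_le₀ (by linarith [pi_gt_three])
  rw [biotSavart, enorm_smul]
  refine (mul_le_of_le_one_left' h1).trans ((enorm_integral_le_lintegral_enorm _).trans_eq ?_)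
  refine lintegral_congr fun u => ?_
  rw [← ofReal_norm]
  congr 1
  simp only [norm_div, norm_mul, Complex.norm_I, one_mul, norm_pow, Complex.norm_real, norm_norm]
  rw [sq, div_self_mul_self']

/-- Remark 2.2: under the growth condition with `α ∈ (0,1)`, the Biot-Savart velocity
is square integrable on every ball. -/
theorem stmt4 (ω : Measure ℂ) [SigmaFinite ω] (c α : ℝ) (hc : 0 < c)
    (hα : α ∈ Set.Ioo (0 : ℝ) 1)
    (hω : ∀ r > (0 : ℝ), ω (ball (0 : ℂ) r) = ENNReal.ofReal (c * r ^ α)) :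
    ∀ R > (0 : ℝ), (∫⁻ x in ball (0 : ℂ) R, (‖biotSavart ω x‖₊ : ℝ≥0∞) ^ 2) < ⊤ := by
  intro R hR
  obtain ⟨h0, h1⟩ := id hα
  set f : ℂ → ℂ → ℝ := fun x y => min (‖x - y‖ ^ (-1 : ℝ)) (‖x - y‖ ^ (-(α / 2))) with hf_def
  set g : ℂ → ℂ → ℝ := fun x y => if ‖x - y‖ < 1 then ‖x - y‖ ^ (-(2 - α / 2)) else 0 with hg_def
  have hf0 : ∀ x y, 0 ≤ f x y := fun x y => by positivity
  have hg0 : ∀ x y, 0 ≤ g x y := fun x y => by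
    simp only [hg_def]
    split_ifs <;> positivity
  have hfm : Measurable (Function.uncurry f) := by
    simp only [hf_def, Function.uncurry_def]
    fun_prop
  have hgm : Measurable (Function.uncurry g) := by
    simp only [hg_def, Function.uncurry_def]
    exact Measurable.ite (measurableSet_lt (by fun_prop) (by fun_prop)) (by fun_prop)
      measurable_const
  obtain ⟨K, hK, hfK⟩ : ∃ K < ⊤, ∀ x, ∫⁻ y, ENNReal.ofReal (f x y) ∂ω ≤ K := by
    refine ⟨_, ENNReal.mul_lt_top (ENNReal.ofReal_lt_top (r := c * 2 ^ α))
      (lintegral_min_rpow_lt_top h1 one_lt_two), fun x =>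
      lintegral_ofReal_le_of_weak_bounds ω hfm.of_uncurry_left (hf0 x) _ _ _
        (fun t ht => ?_) fun t ht => ?_⟩
    · refine (measure_mono fun y hy => ?_).trans
        ((measure_ball_le_of_radial_growth hc hα hω x (rpow_pos_of_pos ht (-1⁻¹))).trans_eq ?_)
      · rw [mem_ball, dist_comm, dist_eq_norm]
        exact lt_rpow_of_lt_rpow_neg (norm_nonneg _) ht one_pos (hy.trans_le (min_le_left _ _))
      · rw [← rpow_mul ht.le]
        simp
    · refine (measure_mono fun y hy => ?_).trans
        ((measure_ball_le_of_radial_growth hc hα hω x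
          (rpow_pos_of_pos ht (-(α / 2)⁻¹))).trans_eq ?_)
      · rw [mem_ball, dist_comm, dist_eq_norm]
        exact lt_rpow_of_lt_rpow_neg (norm_nonneg _) ht (by positivity)
          (hy.trans_le (min_le_right _ _))
      · rw [← rpow_mul ht.le, show -(α / 2)⁻¹ * α = -2 by field_simp]
  obtain ⟨L, hL, hgL⟩ : ∃ L < ⊤, ∀ y, ∫⁻ x, ENNReal.ofReal (g x y) ≤ L := by
    have hball : ∀ y : ℂ, ∀ r > 0, volume (ball y r) = NNReal.pi * ENNReal.ofReal (r ^ 2) :=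
      fun y r hr => by rw [Complex.volume_ball, ENNReal.ofReal_pow hr.le, mul_comm]
    refine ⟨_, ENNReal.mul_lt_top (ENNReal.coe_lt_top (r := NNReal.pi))
      (lintegral_min_rpow_lt_top (a := 0) (b := 2 / (2 - α / 2)) one_pos
        ((one_lt_div (by linarith)).2 (by linarith))), fun y =>
      lintegral_ofReal_le_of_weak_bounds volume hgm.of_uncurry_right (fun x => hg0 x y) _ _ _
        (fun t ht => ?_) fun t ht => ?_⟩
    · refine (measure_mono fun x hx => ?_).trans_eq ((hball y 1 one_pos).trans ?_)
      · rw [mem_ball, dist_eq_norm]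
        by_contra h
        simp only [hg_def, Set.mem_ofPred_eq, h, if_false] at hx
        exact ht.not_gt hx
      · simp
    · refine (measure_mono fun x hx => ?_).trans_eq
        ((hball y _ (rpow_pos_of_pos ht (-(2 - α / 2)⁻¹))).trans ?_)
      · rw [mem_ball, dist_eq_norm]
        refine lt_rpow_of_lt_rpow_neg (norm_nonneg _) ht (by linarith) ?_
        simp only [hg_def, Set.mem_ofPred_eq] at hx
        split_ifs at hx
        exacts [hx, absurd hx ht.not_gt]
      · rw [← rpow_natCast, ← rpow_mul ht.le]
        congr 3
        push_cast
        ring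
  have hpt : ∀ x, (‖biotSavart ω x‖₊ : ℝ≥0∞) ^ 2 ≤
      K * (K + ∫⁻ y, ENNReal.ofReal (g x y) ∂ω) := fun x => by
    have hfx : Measurable fun y => ENNReal.ofReal (f x y) := hfm.of_uncurry_left.ennreal_ofReal
    have hgx : Measurable fun y => ENNReal.ofReal (g x y) := hgm.of_uncurry_left.ennreal_ofReal
    refine (pow_le_pow_left' (enorm_biotSavart_le ω x) 2).trans
      ((lintegral_sq_le_of_sq_le_mul ω hfx (hfx.add hgx) fun y => ?_).trans ?_)
    · simp only [Pi.add_apply]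
      rw [← ENNReal.ofReal_add (hf0 x y) (hg0 x y), ← ENNReal.ofReal_mul (hf0 x y),
        ← ENNReal.ofReal_pow (by positivity)]
      exact ENNReal.ofReal_le_ofReal (rpow_neg_two_le hα (norm_nonneg _))
    · simp only [Pi.add_apply]
      rw [lintegral_add_left hfx]
      gcongr
      exacts [hfK x, hfK x]
  have hgm' : Measurable (Function.uncurry fun x y => ENNReal.ofReal (g x y)) :=
    hgm.ennreal_ofReal
  have hnear : ∫⁻ x in ball (0 : ℂ) R, ∫⁻ y, ENNReal.ofReal (g x y) ∂ω < ⊤ := by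
    rw [lintegral_lintegral_swap hgm'.aemeasurable]
    calc _ ≤ ∫⁻ y, (ball (0 : ℂ) (R + 1)).indicator (fun _ => L) y ∂ω := by
          refine lintegral_mono fun y => ?_
          by_cases hy : y ∈ ball (0 : ℂ) (R + 1)
          · rw [Set.indicator_of_mem hy]
            exact (setLIntegral_le_lintegral _ _).trans (hgL y)
          · rw [Set.indicator_of_notMem hy, nonpos_iff_eq_zero,
              setLIntegral_congr_fun measurableSet_ball (g := fun _ => 0) fun x hx => ?_,
              lintegral_zero]
            have hxy : ¬ ‖x - y‖ < 1 := fun h => hy <| by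
              rw [mem_ball_zero_iff] at hx ⊢
              have := norm_sub_norm_le y x
              rw [norm_sub_rev] at this
              linarith
            simp [hg_def, hxy]
      _ < ⊤ := by
          rw [lintegral_indicator_const measurableSet_ball, hω _ (by linarith)]
          exact ENNReal.mul_lt_top hL ENNReal.ofReal_lt_top
  refine (lintegral_mono hpt).trans_lt ?_
  have hG : Measurable fun x => ∫⁻ y, ENNReal.ofReal (g x y) ∂ω := hgm'.lintegral_prod_right'
  rw [lintegral_const_mul _ (hG.const_add K),
    lintegral_add_left measurable_const, setLIntegral_const]
  exact ENNReal.mul_lt_top hK (ENNReal.add_lt_top.2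
    ⟨ENNReal.mul_lt_top hK measure_ball_lt_top, hnear⟩)
end

section
/- Let u, v ∈ ℂ and r > 0 with |u| ≠ r and |v| ≠ r. Then (2π)^{−1} ∫_0^{2π} ((u − r·e^{iθ})(v − r·e^{−iθ}))^{−1} dθ equals (uv − r²)^{−1} if |u| > r and |v| > r; equals (r² − uv)^{−1} if |u| < r and |v| < r; and equals 0 if (|u| − r)(|v| − r) < 0. -/
open MeasureTheory Metric Real Filter
open scoped ENNReal NNReal Topology

/-- With `z = r e^{iθ}`, so that `r e^{-iθ} = r² / z`, the integral is a circle average of a rational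
function of `z`. -/
lemma cauchyKernel_integral_eq_circleAverage (u v : ℂ) {r : ℝ} (hr : 0 < r) :
    (2 * π)⁻¹ •
      (∫ θ in (0 : ℝ)..(2 * π),
        ((u - (r : ℂ) * Complex.exp ((θ : ℂ) * Complex.I)) *
          (v - (r : ℂ) * Complex.exp (-(θ : ℂ) * Complex.I)))⁻¹) =
      circleAverage (fun z ↦ z / ((u - z) * (v * z - (r : ℂ) ^ 2))) 0 r := by
  rw [circleAverage_def]
  congr 1
  refine intervalIntegral.integral_congr fun θ _ ↦ ?_
  have hr' : (r : ℂ) ≠ 0 := by exact_mod_cast hr.ne'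
  have he := Complex.exp_ne_zero ((θ : ℂ) * Complex.I)
  have key : v * (r * Complex.exp ((θ : ℂ) * Complex.I)) - (r : ℂ) ^ 2 =
      (r * Complex.exp ((θ : ℂ) * Complex.I)) *
        (v - (r : ℂ) * (Complex.exp ((θ : ℂ) * Complex.I))⁻¹) := by
    field_simp
  simp only [circleMap, zero_add, neg_mul, Complex.exp_neg]
  rw [key, mul_left_comm, div_mul_cancel_left₀ (mul_ne_zero hr' he)]

lemma cauchyKernel_integral_comm (u v : ℂ) (r : ℝ) :
    (∫ θ in (0 : ℝ)..(2 * π),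
      ((u - (r : ℂ) * Complex.exp ((θ : ℂ) * Complex.I)) *
        (v - (r : ℂ) * Complex.exp (-(θ : ℂ) * Complex.I)))⁻¹) =
    ∫ θ in (0 : ℝ)..(2 * π),
      ((v - (r : ℂ) * Complex.exp ((θ : ℂ) * Complex.I)) *
        (u - (r : ℂ) * Complex.exp (-(θ : ℂ) * Complex.I)))⁻¹ := by
  have h := intervalIntegral.integral_comp_sub_left (a := 0) (b := 2 * π) (fun θ : ℝ ↦
    ((u - (r : ℂ) * Complex.exp ((θ : ℂ) * Complex.I)) *
      (v - (r : ℂ) * Complex.exp (-(θ : ℂ) * Complex.I)))⁻¹) (2 * π)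
  rw [sub_self, sub_zero] at h
  rw [← h]
  refine intervalIntegral.integral_congr fun θ _ ↦ ?_
  have h₁ : Complex.exp (((2 * π - θ : ℝ) : ℂ) * Complex.I) =
      Complex.exp (-(θ : ℂ) * Complex.I) := by
    rw [← Complex.exp_periodic (-(θ : ℂ) * Complex.I)]
    congr 1
    push_cast
    ring
  have h₂ : Complex.exp (-((2 * π - θ : ℝ) : ℂ) * Complex.I) =
      Complex.exp ((θ : ℂ) * Complex.I) := by
    rw [neg_mul, Complex.exp_neg, h₁, ← Complex.exp_neg, neg_mul, neg_neg]
  simp only [h₁, h₂]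
  exact congrArg _ (mul_comm _ _)

lemma sub_ne_zero_of_norm_ne {E : Type*} [NormedAddGroup E] {a b : E} (h : ‖a‖ ≠ ‖b‖) :
    a - b ≠ 0 :=
  sub_ne_zero.2 fun hab ↦ h (congrArg norm hab)

lemma mul_sub_sq_ne_zero {v z : ℂ} {r : ℝ} (hr : 0 < r) (hv : ‖v‖ < r) (hz : ‖z‖ ≤ r) :
    v * z - (r : ℂ) ^ 2 ≠ 0 := by
  refine sub_ne_zero_of_norm_ne (ne_of_lt ?_)
  rw [norm_mul, norm_pow, Complex.norm_of_nonneg hr.le]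
  nlinarith [norm_nonneg v, norm_nonneg z]

lemma circleAverage_cauchyKernel_of_lt_of_lt {u v : ℂ} {r : ℝ} (hr : 0 < r) (hu : r < ‖u‖)
    (hv : r < ‖v‖) :
    circleAverage (fun z ↦ z / ((u - z) * (v * z - (r : ℂ) ^ 2))) 0 r =
      (u * v - (r : ℂ) ^ 2)⁻¹ := by
  have hv0 : v ≠ 0 := norm_pos_iff.1 (hr.trans hv)
  have hd : DiffContOnCl ℂ (fun z ↦ (v * (u - z))⁻¹) (ball 0 |r|) := by
    rw [abs_of_pos hr]
    refine DifferentiableOn.diffContOnCl_ball (U := closedBall 0 r) (fun z hz ↦ ?_) subset_rfl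
    have hz' : ‖z‖ ≤ r := by simpa using hz
    have : u - z ≠ 0 := sub_ne_zero_of_norm_ne (by linarith)
    exact DifferentiableAt.differentiableWithinAt (by fun_prop (disch := positivity))
  have hw : (r : ℂ) ^ 2 / v ∈ ball (0 : ℂ) |r| := by
    rw [abs_of_pos hr, mem_ball_zero_iff, norm_div, norm_pow, Complex.norm_of_nonneg hr.le,
      div_lt_iff₀ (hr.trans hv)]
    nlinarith
  have h := hd.circleAverage_smul_div hw
  have he : v * (u - (r : ℂ) ^ 2 / v) = u * v - (r : ℂ) ^ 2 := by field_simp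
  rw [he] at h
  rw [← h]
  congr 1
  ext z
  have hz : v * z - (r : ℂ) ^ 2 = v * (z - (r : ℂ) ^ 2 / v) := by field_simp
  rw [hz, sub_zero, smul_eq_mul, ← div_eq_mul_inv, div_div]
  congr 1
  ring

lemma circleAverage_cauchyKernel_of_gt_of_gt {u v : ℂ} {r : ℝ} (hr : 0 < r) (hu : ‖u‖ < r)
    (hv : ‖v‖ < r) :
    circleAverage (fun z ↦ z / ((u - z) * (v * z - (r : ℂ) ^ 2))) 0 r =
      ((r : ℂ) ^ 2 - u * v)⁻¹ := by
  have hd : DiffContOnCl ℂ (fun z ↦ ((r : ℂ) ^ 2 - v * z)⁻¹) (ball 0 |r|) := by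
    rw [abs_of_pos hr]
    refine DifferentiableOn.diffContOnCl_ball (U := closedBall 0 r) (fun z hz ↦ ?_) subset_rfl
    have : (r : ℂ) ^ 2 - v * z ≠ 0 :=
      sub_ne_zero.2 (sub_ne_zero.1 (mul_sub_sq_ne_zero hr hv (by simpa using hz))).symm
    exact DifferentiableAt.differentiableWithinAt (by fun_prop (disch := assumption))
  have h := hd.circleAverage_smul_div (w := u) (by simpa [abs_of_pos hr] using hu)
  rw [mul_comm v u] at h
  rw [← h]
  congr 1
  ext z
  rw [sub_zero, smul_eq_mul, ← div_eq_mul_inv, div_div]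
  congr 1
  ring

lemma circleAverage_cauchyKernel_of_lt_of_gt {u v : ℂ} {r : ℝ} (hr : 0 < r) (hu : r < ‖u‖)
    (hv : ‖v‖ < r) :
    circleAverage (fun z ↦ z / ((u - z) * (v * z - (r : ℂ) ^ 2))) 0 r = 0 := by
  have hd : DiffContOnCl ℂ (fun z ↦ z / ((u - z) * (v * z - (r : ℂ) ^ 2))) (ball 0 |r|) := by
    rw [abs_of_pos hr]
    refine DifferentiableOn.diffContOnCl_ball (U := closedBall 0 r) (fun z hz ↦ ?_) subset_rfl
    have hz' : ‖z‖ ≤ r := by simpa using hz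
    have : (u - z) * (v * z - (r : ℂ) ^ 2) ≠ 0 :=
      mul_ne_zero (sub_ne_zero_of_norm_ne (by linarith)) (mul_sub_sq_ne_zero hr hv hz')
    exact DifferentiableAt.differentiableWithinAt (by fun_prop (disch := assumption))
  simpa using hd.circleAverage

/-- Lemma 3.5: the key cancellation identity for circle integrals. -/
theorem stmt7 (u v : ℂ) (r : ℝ) (hr : 0 < r) (hu : ‖u‖ ≠ r) (hv : ‖v‖ ≠ r) :
    (2 * π)⁻¹ •
      (∫ θ in (0 : ℝ)..(2 * π),
        ((u - (r : ℂ) * Complex.exp ((θ : ℂ) * Complex.I)) *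
          (v - (r : ℂ) * Complex.exp (-(θ : ℂ) * Complex.I)))⁻¹) =
      if r < ‖u‖ ∧ r < ‖v‖ then (u * v - (r : ℂ) ^ 2)⁻¹
      else if ‖u‖ < r ∧ ‖v‖ < r then ((r : ℂ) ^ 2 - u * v)⁻¹
      else 0 := by
  rcases hu.lt_or_gt with hu | hu <;> rcases hv.lt_or_gt with hv | hv
  · rw [cauchyKernel_integral_eq_circleAverage u v hr,
      circleAverage_cauchyKernel_of_gt_of_gt hr hu hv, if_neg (fun h ↦ hu.not_gt h.1),
      if_pos ⟨hu, hv⟩]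
  · rw [cauchyKernel_integral_comm, cauchyKernel_integral_eq_circleAverage v u hr,
      circleAverage_cauchyKernel_of_lt_of_gt hr hv hu, if_neg (fun h ↦ hu.not_gt h.1),
      if_neg (fun h ↦ hv.not_gt h.2)]
  · rw [cauchyKernel_integral_eq_circleAverage u v hr,
      circleAverage_cauchyKernel_of_lt_of_gt hr hu hv, if_neg (fun h ↦ hv.not_gt h.2),
      if_neg (fun h ↦ hu.not_gt h.1)]
  · rw [cauchyKernel_integral_eq_circleAverage u v hr,
      circleAverage_cauchyKernel_of_lt_of_lt hr hu hv, if_pos ⟨hu, hv⟩]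
end
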